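/- arXiv:2602.17946 — 2 statements merged into one kernel-verified Lean document; each statement's English description precedes it below -/
import Mathlib

section
/- If k ≥ r+1 > 3, then every n-vertex r-uniform hypergraph containing no Berge path of length k has at most (n/k)·C(k,r) hyperedges; moreover, if k divides n, then there exists an n-vertex r-uniform hypergraph with exactly (n/k)·C(k,r) hyperedges and no Berge path of length k. -/
/-- A Berge path of length `k` in a hypergraph with hyperedge set `E`. -/
def IsBergePath {V : Type*} (E : Finset (Finset V)) (k : ℕ)
    (v : Fin (k + 1) → V) (h : Fin k → Finset V) : Prop :=
  Function.Injective v ∧ Function.Injective h ∧ (∀ i, h i ∈ E) ∧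
    ∀ i : Fin k, v i.castSucc ∈ h i ∧ v i.succ ∈ h i

def HasBergePath {V : Type*} (E : Finset (Finset V)) (k : ℕ) : Prop :=
  ∃ v h, IsBergePath E k v h

section ListPath

variable {α : Type*} {R : α → α → Prop}

/-- A list without repetitions whose consecutive entries are related by `R`. -/
def IsListPath (R : α → α → Prop) (l : List α) : Prop :=
  l.IsChain R ∧ l.Nodup

/-- The list obtained from `l` by reversing its first `i` entries. -/
def reversePrefix (l : List α) (i : ℕ) : List α :=
  (l.take i).reverse ++ l.drop i

lemma reversePrefix_perm (l : List α) (i : ℕ) : (reversePrefix l i).Perm l := by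
  have h := (List.reverse_perm (l.take i)).append_right (l.drop i)
  rwa [List.take_append_drop] at h

lemma getElem?_reversePrefix_of_le (l : List α) {i m : ℕ} (h : i ≤ m) (hi : i ≤ l.length) :
    (reversePrefix l i)[m]? = l[m]? := by
  rw [reversePrefix, List.getElem?_append_right (by simp; omega), List.getElem?_drop]
  congr 1
  simp
  omega

lemma getElem?_zero_reversePrefix (l : List α) {i : ℕ} (hi : i < l.length) :
    (reversePrefix l (i + 1))[0]? = l[i]? := by
  rw [reversePrefix, List.getElem?_append_left (by simp; omega),
    List.getElem?_reverse (by simp; omega), List.getElem?_take]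
  have : min (i + 1) l.length = i + 1 := by omega
  simp [this]

lemma IsListPath.reverse (hR : ∀ a b, R a b → R b a) {l : List α} (h : IsListPath R l) :
    IsListPath R l.reverse := by
  refine ⟨List.isChain_reverse.2 (h.1.imp fun a b hab => hR a b hab), List.nodup_reverse.2 h.2⟩

lemma IsListPath.reversePrefix (hR : ∀ a b, R a b → R b a) {l : List α} (h : IsListPath R l) {i : ℕ}
    {x y : α} (hx : l[0]? = some x) (hy : l[i]? = some y) (hxy : R x y) :
    IsListPath R (reversePrefix l i) := by
  refine ⟨?_, (reversePrefix_perm l i).nodup_iff.2 h.2⟩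
  rw [_root_.reversePrefix, List.isChain_append]
  refine ⟨List.isChain_reverse.2 ((h.1.take i).imp fun a b hab => hR a b hab), h.1.drop i, ?_⟩
  intro a ha b hb
  rw [List.getLast?_reverse, List.head?_take] at ha
  rw [List.head?_drop, hy] at hb
  obtain rfl : y = b := by simpa using hb
  split_ifs at ha with hi
  · simp at ha
  · rw [List.head?_eq_getElem?, hx] at ha
    obtain rfl : x = a := by simpa using ha
    exact hxy

lemma IsListPath.cons {l : List α} (h : IsListPath R l) {x y : α} (hy : l[0]? = some y)
    (hxy : R x y) (hx : x ∉ l) : IsListPath R (x :: l) := by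
  refine ⟨List.isChain_cons.2 ⟨?_, h.1⟩, List.nodup_cons.2 ⟨hx, h.2⟩⟩
  intro z hz
  rw [List.head?_eq_getElem?, hy] at hz
  obtain rfl : y = z := by simpa using hz
  exact hxy

/-- A closed path can be cut open at any of its entries. -/
lemma IsListPath.exists_perm_head {l : List α} (h : IsListPath R l) {a b : α}
    (ha : l[0]? = some a) (hb : l.getLast? = some b) (hba : R b a) {x : α} (hx : x ∈ l) :
    ∃ q : List α, q.Perm l ∧ IsListPath R q ∧ q[0]? = some x := by
  obtain ⟨s, t, rfl⟩ := List.append_of_mem hx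
  have hp : (x :: t ++ s).Perm (s ++ x :: t) := List.perm_append_comm
  refine ⟨x :: t ++ s, hp, ⟨?_, hp.nodup_iff.2 h.2⟩, by simp⟩
  obtain ⟨h1, h2, -⟩ := List.isChain_append.1 h.1
  refine List.isChain_append.2 ⟨h2, h1, ?_⟩
  intro u hu v hv
  rw [List.getLast?_append, Option.mem_def.1 hu] at hb
  rw [← List.head?_eq_getElem?, List.head?_append, Option.mem_def.1 hv] at ha
  obtain rfl : u = b := by simpa using hb
  obtain rfl : v = a := by simpa using ha
  exact hba

end ListPath

lemma exists_greatest_of_bounded {P : ℕ → Prop} {k : ℕ} (h : ∃ n, P n) (hb : ∀ n, P n → n ≤ k) :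
    ∃ m, P m ∧ ∀ n, P n → n ≤ m := by
  classical
  obtain ⟨n, hn⟩ := h
  exact ⟨Nat.findGreatest P k, Nat.findGreatest_spec (hb n hn) hn,
    fun i hi => Nat.le_findGreatest (hb i hi) hi⟩

section Graph

variable {V : Type*}

/-- The neighbours of a vertex which lie on a path without repetitions are at most as many as
their positions on the path. -/
lemma card_filter_le_card_positions [DecidableEq V] {R : V → V → Prop} [DecidableRel R]
    {U : Finset V} {l : List V} {v : V} (h : ∀ w ∈ U, R v w → w ∈ l) :
    (U.filter (R v)).card ≤
      ((Finset.range l.length).filter fun i => ∃ w ∈ l[i]?, R v w).card := by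
  refine Finset.card_le_card_of_injOn (fun w => l.idxOf w) ?_ ?_
  · intro w hw
    obtain ⟨hwU, hvw⟩ := Finset.mem_filter.1 (Finset.mem_coe.1 hw)
    have hwl := h w hwU hvw
    refine Finset.mem_coe.2 (Finset.mem_filter.2 ⟨?_, w, ?_, hvw⟩)
    · simpa using List.idxOf_lt_length_iff.2 hwl
    · simpa using List.getElem?_idxOf hwl
  · intro w hw w' hw' hww
    obtain ⟨hwU, hvw⟩ := Finset.mem_filter.1 (Finset.mem_coe.1 hw)
    exact (List.idxOf_inj (h w hwU hvw)).1 hww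

/-- A graph without paths on more than `k` vertices has a vertex of degree less than `k / 2`, or
a union of components on at most `k` vertices. -/
lemma exists_low_degree_or_small_component {R : V → V → Prop} [DecidableRel R]
    (hR : ∀ a b, R a b → R b a) (hirr : ∀ a, ¬ R a a) {U : Finset V} (hU : U.Nonempty) {k : ℕ}
    (hk : ∀ l : List V, IsListPath R l → (∀ x ∈ l, x ∈ U) → l.length ≤ k) :
    (∃ v ∈ U, 2 * (U.filter (R v)).card + 1 ≤ k) ∨
      ∃ C ⊆ U, C.Nonempty ∧ C.card ≤ k ∧ ∀ x ∈ C, ∀ y ∈ U, R x y → y ∈ C := by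
  classical
  obtain ⟨u, hu⟩ := hU
  obtain ⟨m, ⟨l, hl, hlU, hlm⟩, hmax⟩ := exists_greatest_of_bounded
    (P := fun n => ∃ l, IsListPath R l ∧ (∀ x ∈ l, x ∈ U) ∧ l.length = n) (k := k)
    ⟨1, [u], ⟨List.isChain_singleton u, List.nodup_singleton u⟩, by simpa using hu, rfl⟩
    (by rintro n ⟨l, hl, hlU, rfl⟩; exact hk l hl hlU)
  have hm1 : 1 ≤ m := hmax 1
    ⟨[u], ⟨List.isChain_singleton u, List.nodup_singleton u⟩, by simpa using hu, rfl⟩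
  have hmk : m ≤ k := hlm ▸ hk l hl hlU
  have hext : ∀ q : List V, q.Perm l → IsListPath R q → ∀ x, q[0]? = some x →
      ∀ y ∈ U, R x y → y ∈ l := by
    intro q hql hq x hx y hy hxy
    by_contra hyl
    have := hmax (m + 1) ⟨y :: q, hq.cons hx (hR _ _ hxy) (fun h => hyl (hql.mem_iff.1 h)), ?_, ?_⟩
    · omega
    · intro z hz
      rcases List.mem_cons.1 hz with rfl | hz
      · exact hy
      · exact hlU z (hql.mem_iff.1 hz)
    · simp [hql.length_eq, hlm]
  obtain ⟨x, hx⟩ : ∃ x, l[0]? = some x := ⟨l[0], List.getElem?_eq_getElem (by omega)⟩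
  obtain ⟨y, hy⟩ : ∃ y, l[m - 1]? = some y := ⟨l[m - 1], List.getElem?_eq_getElem (by omega)⟩
  have hy' : l.reverse[0]? = some y := by
    rw [List.getElem?_reverse (by omega)]
    simpa [hlm] using hy
  by_cases hdx : 2 * (U.filter (R x)).card + 1 ≤ k
  · exact Or.inl ⟨x, hlU x (List.mem_of_getElem? hx), hdx⟩
  by_cases hdy : 2 * (U.filter (R y)).card + 1 ≤ k
  · exact Or.inl ⟨y, hlU y (List.mem_of_getElem? hy), hdy⟩
  right
  have hA := card_filter_le_card_positions (hext l (List.Perm.refl l) hl x hx)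
  have hB := card_filter_le_card_positions (hext _ (List.reverse_perm l) (hl.reverse hR) y hy')
  set A := (Finset.range l.length).filter fun i => ∃ w ∈ l[i]?, R x w with hAdef
  set B := (Finset.range l.length).filter fun i => ∃ w ∈ l[i]?, R y w with hBdef
  have hcross : ∃ i ∈ A, ∃ j ∈ B, i = j + 1 := by
    by_contra! hno
    have hdisj : Disjoint A (B.map (addRightEmbedding 1)) := by
      rw [Finset.disjoint_left]
      intro i hi hi'
      obtain ⟨j, hj, rfl⟩ := Finset.mem_map.1 hi'
      exact hno _ hi j hj rfl
    have hsub : A ∪ B.map (addRightEmbedding 1) ⊆ Finset.Ico 1 m := by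
      intro i hi
      rcases Finset.mem_union.1 hi with hi | hi
      · obtain ⟨h1, w, h2, h3⟩ := Finset.mem_filter.1 hi
        have : i ≠ 0 := by
          rintro rfl
          rw [hx] at h2
          obtain rfl : x = w := by simpa using h2
          exact hirr _ h3
        simp at h1 ⊢
        omega
      · obtain ⟨j, hj, rfl⟩ := Finset.mem_map.1 hi
        obtain ⟨h1, w, h2, h3⟩ := Finset.mem_filter.1 hj
        have : j ≠ m - 1 := by
          rintro rfl
          rw [hy] at h2
          obtain rfl : y = w := by simpa using h2
          exact hirr _ h3
        simp at h1 ⊢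
        omega
    have hcard := Finset.card_le_card hsub
    rw [Finset.card_union_of_disjoint hdisj, Finset.card_map, Nat.card_Ico] at hcard
    omega
  obtain ⟨_, hiA, j, hjB, rfl⟩ := hcross
  obtain ⟨hi1, w, hw, hxw⟩ := Finset.mem_filter.1 hiA
  obtain ⟨hj1, z, hz, hyz⟩ := Finset.mem_filter.1 hjB
  have hj2 : j + 1 < l.length := by simpa using hi1
  have hc := hl.reversePrefix hR hx hw hxw
  have hcl := reversePrefix_perm l (j + 1)
  have hc0 : (reversePrefix l (j + 1))[0]? = some z := by
    rw [getElem?_zero_reversePrefix l (by omega)]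
    exact hz
  have hce : (reversePrefix l (j + 1)).getLast? = some y := by
    rw [List.getLast?_eq_getElem?, hcl.length_eq,
      getElem?_reversePrefix_of_le l (by omega) (by omega), hlm, hy]
  refine ⟨l.toFinset, fun v hv => hlU v (by simpa using hv), ⟨x, ?_⟩, ?_, ?_⟩
  · simpa using List.mem_of_getElem? hx
  · exact (List.toFinset_card_le l).trans (hlm ▸ hmk)
  · intro a ha b hb hab
    obtain ⟨q, hqc, hq, hqa⟩ := hc.exists_perm_head hc0 hce hyz
      (hcl.mem_iff.2 (List.mem_toFinset.1 ha))
    exact List.mem_toFinset.2 (hext q (hqc.trans hcl) hq a hqa b hb hab)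

end Graph

section Choose

lemma self_le_choose {n t : ℕ} (ht : 1 ≤ t) (htn : t + 1 ≤ n) : n ≤ n.choose t := by
  induction n generalizing t with
  | zero => omega
  | succ n ih =>
    obtain ⟨t, rfl⟩ : ∃ u, t = u + 1 := ⟨t - 1, by omega⟩
    rw [Nat.choose_succ_succ']
    rcases Nat.lt_or_ge (t + 1) n with h | h
    · have := ih (t := t + 1) (by omega) (by omega)
      have := Nat.choose_pos (n := n) (k := t) (by omega)
      omega
    · obtain rfl : n = t + 1 := by omega
      simp

lemma choose_two_le_choose {n t : ℕ} (ht : 2 ≤ t) (htn : t + 2 ≤ n) :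
    n.choose 2 ≤ n.choose t := by
  induction n generalizing t with
  | zero => omega
  | succ n ih =>
    rcases Nat.lt_or_ge (t + 1) n with h | h
    · obtain ⟨t, rfl⟩ : ∃ u, t = u + 1 := ⟨t - 1, by omega⟩
      rw [Nat.choose_succ_succ', Nat.choose_succ_succ' n t, Nat.choose_one_right]
      have := ih (t := t + 1) (by omega) (by omega)
      have := self_le_choose (n := n) (t := t) (by omega) (by omega)
      have : n.choose (1 + 1) = n.choose 2 := rfl
      omega
    · exact (Nat.choose_symm_of_eq_add (by omega)).le

lemma two_pow_mul_choose_le (d t : ℕ) : 2 ^ t * d.choose t ≤ (2 * d).choose t := by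
  have h : 2 ^ t * d.descFactorial t ≤ (2 * d).descFactorial t := by
    induction t with
    | zero => simp
    | succ t ih =>
      rw [Nat.descFactorial_succ, Nat.descFactorial_succ]
      calc 2 ^ (t + 1) * ((d - t) * d.descFactorial t)
          = (2 * (d - t)) * (2 ^ t * d.descFactorial t) := by ring
        _ ≤ (2 * d - t) * (2 * d).descFactorial t := Nat.mul_le_mul (by omega) ih
  rw [Nat.descFactorial_eq_factorial_mul_choose, Nat.descFactorial_eq_factorial_mul_choose] at h
  refine le_of_mul_le_mul_left (a := t.factorial) ?_ t.factorial_pos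
  calc _ = 2 ^ t * (t.factorial * d.choose t) := by ring
    _ ≤ _ := h

lemma choose_add_mul_le {b t : ℕ} (ht : 1 ≤ t) (hb : t ≤ b) (s : ℕ) :
    b.choose t + s * t ≤ (b + s).choose t := by
  induction s with
  | zero => simp
  | succ s ih =>
    obtain ⟨t, rfl⟩ : ∃ u, t = u + 1 := ⟨t - 1, by omega⟩
    rw [← add_assoc b s 1, Nat.choose_succ_succ']
    have h : t + 1 ≤ (b + s).choose t := by
      calc t + 1 = (t + 1).choose t := by simp
        _ ≤ _ := Nat.choose_le_choose t (by omega)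
    rw [add_mul, one_mul]
    omega

lemma mul_add_choose_le_of_low_degree {k r s b : ℕ} (hr : 3 ≤ r) (hk : r + 2 ≤ k)
    (hd : 2 * (s + b) + 1 ≤ k) : r * (s + b.choose (r - 1)) ≤ (k - 1).choose (r - 1) := by
  rcases Nat.lt_or_ge b (r - 1) with hb | hb
  · rw [Nat.choose_eq_zero_of_lt hb, add_zero]
    refine le_trans ?_ (choose_two_le_choose (by omega) (by omega))
    rw [Nat.choose_two_right, Nat.le_div_iff_mul_le (by norm_num)]
    calc r * s * 2 = (2 * s) * r := by ring
      _ ≤ (k - 1) * (k - 1 - 1) := Nat.mul_le_mul (by omega) (by omega)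
  · have h1 := choose_add_mul_le (by omega) hb s
    have h2 : s ≤ s * (r - 1) := Nat.le_mul_of_pos_right s (by omega)
    have h3 : r ≤ 2 ^ (r - 1) := by
      have := Nat.lt_two_pow_self (n := r - 1)
      omega
    calc r * (s + b.choose (r - 1)) ≤ 2 ^ (r - 1) * (b + s).choose (r - 1) :=
          Nat.mul_le_mul h3 (by omega)
      _ ≤ (2 * (b + s)).choose (r - 1) := two_pow_mul_choose_le _ _
      _ ≤ _ := Nat.choose_le_choose _ (by omega)

lemma mul_add_two_mul_choose_le {k r s b : ℕ} (hr : 3 ≤ r) (hk : r + 2 ≤ k)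
    (hd : s + b + 1 ≤ k) : r * s + 2 * b.choose (r - 1) ≤ 2 * (k - 1).choose (r - 1) := by
  rcases Nat.lt_or_ge b (r - 1) with hb | hb
  · rw [Nat.choose_eq_zero_of_lt hb, mul_zero, add_zero]
    have h2 : (k - 1).choose 2 * 2 = (k - 1) * (k - 1 - 1) := by
      rw [Nat.choose_two_right]
      exact Nat.div_mul_cancel (Nat.even_mul_pred_self (k - 1)).two_dvd
    calc r * s = s * r := by ring
      _ ≤ (k - 1) * (k - 1 - 1) := Nat.mul_le_mul (by omega) (by omega)
      _ = 2 * (k - 1).choose 2 := by rw [← h2, mul_comm]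
      _ ≤ _ := Nat.mul_le_mul_left 2 (choose_two_le_choose (by omega) (by omega))
  · have h1 := choose_add_mul_le (by omega) hb s
    have h2 : (b + s).choose (r - 1) ≤ (k - 1).choose (r - 1) :=
      Nat.choose_le_choose _ (by omega)
    have h3 : r * s ≤ 2 * (s * (r - 1)) := by
      calc r * s = s * r := by ring
        _ ≤ s * (2 * (r - 1)) := Nat.mul_le_mul_left s (by omega)
        _ = _ := by ring
    omega

end Choose

section RedBlue

variable {V : Type*} [DecidableEq V]

lemma card_filter_subset_le_add (F : Finset (Finset V)) (U C : Finset V) :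
    (F.filter (· ⊆ U)).card ≤
      (F.filter (· ⊆ U \ C)).card + (F.filter fun T => T ⊆ U ∧ ¬ Disjoint T C).card := by
  refine le_trans (Finset.card_le_card ?_) (Finset.card_union_le _ _)
  intro T hT
  obtain ⟨h1, h2⟩ := Finset.mem_filter.1 hT
  rw [Finset.mem_union, Finset.mem_filter, Finset.mem_filter, Finset.subset_sdiff]
  tauto

lemma mul_card_eq_sum_degrees {F : Finset (Finset V)} {C : Finset V} {m : ℕ}
    (hm : ∀ T ∈ F, T.card = m) (hC : ∀ T ∈ F, T ⊆ C) :
    m * F.card = ∑ v ∈ C, (F.filter (v ∈ ·)).card := by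
  have h := Finset.sum_card_bipartiteAbove_eq_sum_card_bipartiteBelow
    (s := C) (t := F) (fun v T => v ∈ T)
  change ∑ v ∈ C, (F.filter (v ∈ ·)).card = ∑ T ∈ F, (C.filter (· ∈ T)).card at h
  rw [h, mul_comm, ← smul_eq_mul, ← Finset.sum_const]
  refine Finset.sum_congr rfl fun T hT => ?_
  rw [Finset.filter_mem_eq_inter, Finset.inter_eq_right.2 (hC T hT), hm T hT]

lemma card_pairs_at_le {F : Finset (Finset V)} {U : Finset V} (hF : ∀ p ∈ F, p.card = 2) (v : V) :
    (F.filter fun p => p ⊆ U ∧ v ∈ p).card ≤ (U.filter fun w => w ≠ v ∧ {v, w} ∈ F).card := by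
  refine le_trans (Finset.card_le_card ?_)
    (Finset.card_image_le (f := fun w => ({v, w} : Finset V)))
  intro p hp
  obtain ⟨hpF, hpU, hvp⟩ := Finset.mem_filter.1 hp
  obtain ⟨a, b, hab, rfl⟩ := Finset.card_eq_two.1 (hF p hpF)
  rw [Finset.mem_image]
  rcases Finset.mem_insert.1 hvp with rfl | h
  · exact ⟨b, Finset.mem_filter.2 ⟨hpU (by simp), hab.symm, hpF⟩, rfl⟩
  · obtain rfl := Finset.mem_singleton.1 h
    exact ⟨a, Finset.mem_filter.2 ⟨hpU (by simp), hab, by rwa [Finset.pair_comm]⟩,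
      Finset.pair_comm _ _⟩

lemma card_cliques_at_le {K B : Finset (Finset V)} {U : Finset V} {r : ℕ}
    (hK : ∀ T ∈ K, T.card = r) (hKB : ∀ T ∈ K, ∀ x ∈ T, ∀ y ∈ T, x ≠ y → {x, y} ∈ B) (v : V) :
    (K.filter fun T => T ⊆ U ∧ v ∈ T).card ≤
      (U.filter fun w => w ≠ v ∧ {v, w} ∈ B).card.choose (r - 1) := by
  rw [← Finset.card_powersetCard]
  refine Finset.card_le_card_of_injOn (fun T => T.erase v) ?_ ?_
  · intro T hT
    obtain ⟨hTK, hTU, hvT⟩ := Finset.mem_filter.1 (Finset.mem_coe.1 hT)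
    refine Finset.mem_coe.2 (Finset.mem_powersetCard.2 ⟨fun w hw => ?_, ?_⟩)
    · obtain ⟨hwv, hwT⟩ := Finset.mem_erase.1 hw
      exact Finset.mem_filter.2 ⟨hTU hwT, hwv, hKB T hTK v hvT w hwT hwv.symm⟩
    · rw [Finset.card_erase_of_mem hvT, hK T hTK]
  · intro T hT T' hT' h
    obtain ⟨-, -, hvT⟩ := Finset.mem_filter.1 (Finset.mem_coe.1 hT)
    obtain ⟨-, -, hvT'⟩ := Finset.mem_filter.1 (Finset.mem_coe.1 hT')
    rw [← Finset.insert_erase hvT, ← Finset.insert_erase hvT']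
    exact congrArg (insert v) h

lemma card_red_add_card_blue_le {A B : Finset (Finset V)} (hAB : Disjoint A B) (U : Finset V)
    (v : V) : (U.filter fun w => w ≠ v ∧ {v, w} ∈ A).card +
      (U.filter fun w => w ≠ v ∧ {v, w} ∈ B).card ≤
      (U.filter fun w => v ≠ w ∧ {v, w} ∈ A ∪ B).card := by
  rw [← Finset.card_union_of_disjoint]
  · refine Finset.card_le_card fun w hw => ?_
    simp only [Finset.mem_union, Finset.mem_filter] at hw ⊢
    tauto
  · rw [Finset.disjoint_left]
    intro w hw hw'
    exact Finset.disjoint_left.1 hAB (Finset.mem_filter.1 hw).2.2 (Finset.mem_filter.1 hw').2.2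

/-- The number of red edges plus blue `r`-cliques in a graph without paths on `k + 1` vertices. -/
lemma mul_card_red_add_card_cliques_le {A B K : Finset (Finset V)} {r k : ℕ} (hr : 3 ≤ r)
    (hk : r + 2 ≤ k) (hA : ∀ p ∈ A, p.card = 2) (hAB : Disjoint A B)
    (hK : ∀ T ∈ K, T.card = r) (hKB : ∀ T ∈ K, ∀ x ∈ T, ∀ y ∈ T, x ≠ y → {x, y} ∈ B)
    (hpath : ∀ l : List V, IsListPath (fun x y => x ≠ y ∧ {x, y} ∈ A ∪ B) l → l.length ≤ k)
    (U : Finset V) :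
    r * ((A.filter (· ⊆ U)).card + (K.filter (· ⊆ U)).card) ≤
      U.card * (k - 1).choose (r - 1) := by
  induction U using Finset.strongInduction with
  | H U ih =>
  rcases U.eq_empty_or_nonempty with rfl | hU
  · have h1 : A.filter (· ⊆ (∅ : Finset V)) = ∅ := by
      refine Finset.filter_eq_empty_iff.2 fun p hp h => ?_
      have := hA p hp
      simp [Finset.subset_empty.1 h] at this
    have h2 : K.filter (· ⊆ (∅ : Finset V)) = ∅ := by
      refine Finset.filter_eq_empty_iff.2 fun p hp h => ?_
      have := hK p hp
      simp [Finset.subset_empty.1 h] at this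
      omega
    rw [h1, h2]
    simp
  suffices h : ∃ C ⊆ U, C.Nonempty ∧
      r * ((A.filter fun T => T ⊆ U ∧ ¬ Disjoint T C).card +
        (K.filter fun T => T ⊆ U ∧ ¬ Disjoint T C).card) ≤
      C.card * (k - 1).choose (r - 1) by
    obtain ⟨C, hCU, hC, h⟩ := h
    have h1 := ih (U \ C) (Finset.sdiff_ssubset hCU hC)
    have h2 := card_filter_subset_le_add A U C
    have h3 := card_filter_subset_le_add K U C
    have h4 : U.card = (U \ C).card + C.card := (Finset.card_sdiff_add_card_eq_card hCU).symm
    rw [h4, add_mul]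
    refine le_trans (Nat.mul_le_mul_left r (add_le_add h2 h3)) ?_
    calc _ = _ + _ := by rw [add_add_add_comm, mul_add]
      _ ≤ _ := add_le_add h1 h
  rcases exists_low_degree_or_small_component (R := fun x y => x ≠ y ∧ {x, y} ∈ A ∪ B)
    (fun a b h => ⟨h.1.symm, by rw [Finset.pair_comm]; exact h.2⟩) (fun a h => h.1 rfl) hU
    (fun l hl _ => hpath l hl) with ⟨v, hv, hd⟩ | ⟨C, hCU, hC, hCk, hclosed⟩
  · refine ⟨{v}, by simpa using hv, by simp, ?_⟩
    simp only [Finset.disjoint_singleton_right, not_not, Finset.card_singleton, one_mul]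
    have h1 := card_pairs_at_le (U := U) hA v
    have h2 := card_cliques_at_le (U := U) hK hKB v
    have h3 := card_red_add_card_blue_le hAB U v
    exact (Nat.mul_le_mul_left r (add_le_add h1 h2)).trans
      (mul_add_choose_le_of_low_degree hr hk (by omega))
  · refine ⟨C, hCU, hC, ?_⟩
    have hA' : (A.filter fun T => T ⊆ U ∧ ¬ Disjoint T C) ⊆ A.filter (· ⊆ C) := by
      intro p hp
      obtain ⟨hpA, hpU, hpC⟩ := Finset.mem_filter.1 hp
      refine Finset.mem_filter.2 ⟨hpA, fun y hy => ?_⟩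
      obtain ⟨x, hx, hxC⟩ := Finset.not_disjoint_iff.1 hpC
      by_cases hxy : x = y
      · exact hxy ▸ hxC
      refine hclosed x hxC y (hpU hy) ⟨hxy, ?_⟩
      have : ({x, y} : Finset V) = p := Finset.eq_of_subset_of_card_le
        (by simp [Finset.insert_subset_iff, hx, hy]) (by rw [hA p hpA, Finset.card_pair hxy])
      rw [this]
      exact Finset.mem_union_left _ hpA
    have hK' : (K.filter fun T => T ⊆ U ∧ ¬ Disjoint T C) ⊆ K.filter (· ⊆ C) := by
      intro T hT
      obtain ⟨hTK, hTU, hTC⟩ := Finset.mem_filter.1 hT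
      refine Finset.mem_filter.2 ⟨hTK, fun y hy => ?_⟩
      obtain ⟨x, hx, hxC⟩ := Finset.not_disjoint_iff.1 hTC
      by_cases hxy : x = y
      · exact hxy ▸ hxC
      exact hclosed x hxC y (hTU hy)
        ⟨hxy, Finset.mem_union_right _ (hKB T hTK x hx y hy hxy)⟩
    refine le_trans (Nat.mul_le_mul_left r
      (add_le_add (Finset.card_le_card hA') (Finset.card_le_card hK'))) ?_
    have hsA := mul_card_eq_sum_degrees (F := A.filter (· ⊆ C)) (C := C) (m := 2)
      (fun T hT => hA T (Finset.mem_filter.1 hT).1) (fun T hT => (Finset.mem_filter.1 hT).2)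
    have hsK := mul_card_eq_sum_degrees (F := K.filter (· ⊆ C)) (C := C) (m := r)
      (fun T hT => hK T (Finset.mem_filter.1 hT).1) (fun T hT => (Finset.mem_filter.1 hT).2)
    simp only [Finset.filter_filter] at hsA hsK
    have hsum : r * (2 * (A.filter (· ⊆ C)).card) + 2 * (r * (K.filter (· ⊆ C)).card) ≤
        C.card * (2 * (k - 1).choose (r - 1)) := by
      rw [hsA, hsK, Finset.mul_sum, Finset.mul_sum, ← Finset.sum_add_distrib, ← smul_eq_mul]
      refine Finset.sum_le_card_nsmul C _ _ fun v hv => ?_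
      have h1 := card_pairs_at_le (U := C) hA v
      have h2 := card_cliques_at_le (U := C) hK hKB v
      have h3 := card_red_add_card_blue_le hAB C v
      have h4 : (C.filter fun w => v ≠ w ∧ {v, w} ∈ A ∪ B).card + 1 ≤ C.card := by
        rw [Nat.succ_le_iff]
        refine Finset.card_lt_card (Finset.filter_ssubset.2 ⟨v, hv, by simp⟩)
      exact (add_le_add (Nat.mul_le_mul_left r h1) (Nat.mul_le_mul_left 2 h2)).trans
        (mul_add_two_mul_choose_le hr hk (by omega))
    nlinarith

end RedBlue

section Representation

variable {V : Type*} [DecidableEq V]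

/-- Every hypergraph has a system of distinct hyperedges representing the edges of a red and blue
graph such that the hyperedges are at most as many as the red edges plus some hyperedges all of
whose pairs are blue. -/
lemma exists_red_blue_representation (E : Finset (Finset V)) :
    ∃ (A B K : Finset (Finset V)) (f : Finset V → Finset V),
      (∀ p ∈ A, p.card = 2) ∧ Disjoint A B ∧ K ⊆ E ∧
      (∀ T ∈ K, ∀ x ∈ T, ∀ y ∈ T, x ≠ y → {x, y} ∈ B) ∧ E.card ≤ A.card + K.card ∧
      Set.InjOn f (A ∪ B : Finset (Finset V)) ∧ ∀ p ∈ A ∪ B, f p ∈ E ∧ p ⊆ f p := by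
  classical
  let N : Finset (Finset V) → Finset (Finset V) := fun D => D.biUnion (Finset.powersetCard 2)
  obtain ⟨D, hD, hmax⟩ := Finset.exists_max_image E.powerset
    (fun D => (D.card : ℤ) - (N D).card) ⟨∅, by simp⟩
  rw [Finset.mem_powerset] at hD
  have hmemN : ∀ {D' : Finset (Finset V)} {p : Finset V},
      p ∈ N D' ↔ ∃ e ∈ D', p ⊆ e ∧ p.card = 2 := by
    intro D' p
    simp only [N, Finset.mem_biUnion, Finset.mem_powersetCard]
  obtain ⟨g, hg, hgt⟩ := (Finset.all_card_le_biUnion_card_iff_exists_injective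
    (fun e : {e // e ∈ E \ D} => Finset.powersetCard 2 e.1 \ N D)).1 (by
      intro S
      have hS : S.map (Function.Embedding.subtype _) ⊆ E \ D := by
        intro e he
        obtain ⟨e', -, rfl⟩ := Finset.mem_map.1 he
        exact e'.2
      have h1 := hmax (D ∪ S.map (Function.Embedding.subtype _)) (Finset.mem_powerset.2
        (Finset.union_subset hD (hS.trans Finset.sdiff_subset)))
      rw [Finset.card_union_of_disjoint (Finset.disjoint_of_subset_right hS Finset.disjoint_sdiff),
        Finset.card_map] at h1
      have h2 : N (D ∪ S.map (Function.Embedding.subtype _)) ⊆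
          N D ∪ S.biUnion fun e => Finset.powersetCard 2 e.1 \ N D := by
        intro p hp
        by_cases hpD : p ∈ N D
        · exact Finset.mem_union_left _ hpD
        obtain ⟨e, he, hpe⟩ := hmemN.1 hp
        rcases Finset.mem_union.1 he with he | he
        · exact absurd (hmemN.2 ⟨e, he, hpe⟩) hpD
        obtain ⟨e', he', rfl⟩ := Finset.mem_map.1 he
        exact Finset.mem_union_right _ (Finset.mem_biUnion.2 ⟨e', he',
          Finset.mem_sdiff.2 ⟨Finset.mem_powersetCard.2 hpe, hpD⟩⟩)
      have h3 := (Finset.card_le_card h2).trans (Finset.card_union_le _ _)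
      push_cast at h1
      omega)
  obtain ⟨h, hh, hht⟩ := (Finset.all_card_le_biUnion_card_iff_exists_injective
    (fun p : {p // p ∈ N D} => D.filter (p.1 ⊆ ·))).1 (by
      intro S
      set T := S.biUnion fun p : {p // p ∈ N D} => D.filter (p.1 ⊆ ·) with hT
      have hTD : T ⊆ D := Finset.biUnion_subset.2 fun p _ => Finset.filter_subset _ _
      have h1 := hmax (D \ T) (Finset.mem_powerset.2 (Finset.sdiff_subset.trans hD))
      have hS : S.map (Function.Embedding.subtype _) ⊆ N D := by
        intro e he
        obtain ⟨e', -, rfl⟩ := Finset.mem_map.1 he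
        exact e'.2
      have h2 : N (D \ T) ⊆ N D \ S.map (Function.Embedding.subtype _) := by
        intro p hp
        obtain ⟨e, he, hpe⟩ := hmemN.1 hp
        obtain ⟨heD, heT⟩ := Finset.mem_sdiff.1 he
        refine Finset.mem_sdiff.2 ⟨hmemN.2 ⟨e, heD, hpe⟩, fun hpS => heT ?_⟩
        obtain ⟨p', hp', rfl⟩ := Finset.mem_map.1 hpS
        exact Finset.mem_biUnion.2 ⟨p', hp', Finset.mem_filter.2 ⟨heD, hpe.1⟩⟩
      have h3 := Finset.card_le_card h2
      have h4 := Finset.card_sdiff_add_card_eq_card hTD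
      have h5 := Finset.card_sdiff_add_card_eq_card hS
      rw [Finset.card_map] at h5
      omega)
  have hgE : ∀ e, g e ∉ N D ∧ (g e).card = 2 ∧ g e ⊆ e.1 := by
    intro e
    obtain ⟨h1, h2⟩ := Finset.mem_sdiff.1 (hgt e)
    obtain ⟨h3, h4⟩ := Finset.mem_powersetCard.1 h1
    exact ⟨h2, h4, h3⟩
  have hhD : ∀ p, h p ∈ D ∧ p.1 ⊆ h p := fun p => Finset.mem_filter.1 (hht p)
  let f : Finset V → Finset V := fun p =>
    if hp : p ∈ N D then h ⟨p, hp⟩ else Function.extend g Subtype.val (fun _ => ∅) p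
  have hfN : ∀ p (hp : p ∈ N D), f p = h ⟨p, hp⟩ := fun p hp => dif_pos hp
  have hfg : ∀ e, f (g e) = e.1 := by
    intro e
    have h1 : f (g e) = Function.extend g Subtype.val (fun _ => ∅) (g e) := dif_neg (hgE e).1
    rw [h1, hg.extend_apply]
  refine ⟨Finset.univ.image g, N D, D, f, ?_, ?_, hD, ?_, ?_, ?_, ?_⟩
  · intro p hp
    obtain ⟨e, -, rfl⟩ := Finset.mem_image.1 hp
    exact (hgE e).2.1
  · rw [Finset.disjoint_left]
    intro p hp
    obtain ⟨e, -, rfl⟩ := Finset.mem_image.1 hp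
    exact (hgE e).1
  · intro T hT x hx y hy hxy
    exact hmemN.2 ⟨T, hT, by simp [Finset.insert_subset_iff, hx, hy], Finset.card_pair hxy⟩
  · rw [Finset.card_image_of_injective _ hg, Finset.card_univ, Fintype.card_coe,
      Finset.card_sdiff_add_card_eq_card hD]
  · intro p hp q hq hpq
    rw [Finset.mem_coe, Finset.mem_union, Finset.mem_image] at hp hq
    rcases hp with ⟨e, -, rfl⟩ | hp <;> rcases hq with ⟨e', -, rfl⟩ | hq
    · rw [hfg, hfg] at hpq
      rw [Subtype.ext hpq]
    · rw [hfg, hfN q hq] at hpq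
      exact absurd (hpq ▸ (hhD ⟨q, hq⟩).1) (Finset.mem_sdiff.1 e.2).2
    · rw [hfg, hfN p hp] at hpq
      exact absurd (hpq ▸ (hhD ⟨p, hp⟩).1) (Finset.mem_sdiff.1 e'.2).2
    · rw [hfN p hp, hfN q hq] at hpq
      exact congrArg Subtype.val (hh hpq)
  · intro p hp
    rw [Finset.mem_union, Finset.mem_image] at hp
    rcases hp with ⟨e, -, rfl⟩ | hp
    · rw [hfg]
      exact ⟨(Finset.mem_sdiff.1 e.2).1, (hgE e).2.2⟩
    · rw [hfN p hp]
      exact ⟨hD (hhD ⟨p, hp⟩).1, (hhD ⟨p, hp⟩).2⟩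

lemma hasBergePath_of_representation {E G : Finset (Finset V)} {f : Finset V → Finset V}
    (hinj : Set.InjOn f G) (hf : ∀ p ∈ G, f p ∈ E ∧ p ⊆ f p) {k : ℕ} {l : List V}
    (hl : IsListPath (fun x y => x ≠ y ∧ {x, y} ∈ G) l) (hk : k < l.length) :
    HasBergePath E k := by
  have hc := List.isChain_iff_getElem.1 hl.1
  have hn : ∀ {i j : ℕ} (hi : i < l.length) (hj : j < l.length), l[i] = l[j] ↔ i = j :=
    fun hi hj => hl.2.getElem_inj_iff
  refine ⟨fun i => l[i.1]'(by omega), fun i => f {l[i.1]'(by omega), l[i.1 + 1]'(by omega)},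
    ?_, ?_, fun i => (hf _ (hc i.1 (by omega)).2).1, fun i => ?_⟩
  · intro i j hij
    exact Fin.ext ((hn _ _).1 hij)
  · intro i j hij
    have h := hinj (hc i.1 (by omega)).2 (hc j.1 (by omega)).2 hij
    have h1 : l[i.1]'(by omega) ∈ ({l[j.1]'(by omega), l[j.1 + 1]'(by omega)} : Finset V) := by
      rw [← h]; simp
    have h2 : l[i.1 + 1]'(by omega) ∈ ({l[j.1]'(by omega), l[j.1 + 1]'(by omega)} : Finset V) := by
      rw [← h]; simp
    simp only [Finset.mem_insert, Finset.mem_singleton, hn] at h1 h2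
    omega
  · have h := (hf _ (hc i.1 (by omega)).2).2
    exact ⟨h (by simp), h (by simp)⟩

/-- The upper bound for `r + 2 ≤ k`. -/
lemma mul_card_le_of_not_hasBergePath [Fintype V] {E : Finset (Finset V)} {r k : ℕ} (hr : 3 ≤ r)
    (hk : r + 2 ≤ k) (hE : ∀ e ∈ E, e.card = r) (hno : ¬ HasBergePath E k) :
    r * E.card ≤ Fintype.card V * (k - 1).choose (r - 1) := by
  obtain ⟨A, B, K, f, hA, hAB, hKE, hKB, hcard, hinj, hf⟩ := exists_red_blue_representation E
  have h := mul_card_red_add_card_cliques_le hr hk hA hAB (fun T hT => hE T (hKE hT)) hKB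
    (fun l hl => not_lt.1 fun hlk => hno (hasBergePath_of_representation hinj hf hl hlk))
    Finset.univ
  simp only [Finset.subset_univ, Finset.filter_true, Finset.card_univ] at h
  exact (Nat.mul_le_mul_left r hcard).trans h

end Representation

section Incidence

variable {V : Type*}

/-- The incidence relation between the vertices and the hyperedges of a hypergraph. -/
def Incident (E : Finset (Finset V)) : V ⊕ Finset V → V ⊕ Finset V → Prop
  | Sum.inl v, Sum.inr e => e ∈ E ∧ v ∈ e
  | Sum.inr e, Sum.inl v => e ∈ E ∧ v ∈ e
  | _, _ => False

@[simp] lemma incident_inl_inr {E : Finset (Finset V)} {v : V} {e : Finset V} :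
    Incident E (Sum.inl v) (Sum.inr e) ↔ e ∈ E ∧ v ∈ e := Iff.rfl

@[simp] lemma incident_inr_inl {E : Finset (Finset V)} {v : V} {e : Finset V} :
    Incident E (Sum.inr e) (Sum.inl v) ↔ e ∈ E ∧ v ∈ e := Iff.rfl

@[simp] lemma not_incident_inl_inl {E : Finset (Finset V)} {v w : V} :
    ¬ Incident E (Sum.inl v) (Sum.inl w) := id

@[simp] lemma not_incident_inr_inr {E : Finset (Finset V)} {e f : Finset V} :
    ¬ Incident E (Sum.inr e) (Sum.inr f) := id

lemma incident_symm (E : Finset (Finset V)) (a b : V ⊕ Finset V) (h : Incident E a b) :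
    Incident E b a := by
  rcases a with a | a <;> rcases b with b | b <;> simp_all

lemma IsListPath.rel_getElem? {α : Type*} {R : α → α → Prop} {l : List α} (h : IsListPath R l)
    {i : ℕ} {a b : α} (ha : l[i]? = some a) (hb : l[i + 1]? = some b) : R a b := by
  obtain ⟨h1, rfl⟩ := List.getElem?_eq_some_iff.1 ha
  obtain ⟨h2, rfl⟩ := List.getElem?_eq_some_iff.1 hb
  exact List.isChain_iff_getElem.1 h.1 i h2

lemma IsListPath.getElem?_inj {α : Type*} {R : α → α → Prop} {l : List α} (h : IsListPath R l)
    {i j : ℕ} {a : α} (hi : l[i]? = some a) (hj : l[j]? = some a) : i = j := by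
  obtain ⟨h1, rfl⟩ := List.getElem?_eq_some_iff.1 hi
  obtain ⟨h2, h3⟩ := List.getElem?_eq_some_iff.1 hj
  exact (h.2.getElem_inj_iff.1 h3).symm

lemma lt_length_of_getElem? {α : Type*} {l : List α} {i : ℕ} {a : α} (h : l[i]? = some a) :
    i < l.length :=
  (List.getElem?_eq_some_iff.1 h).1

lemma exists_getElem?_of_lt {α : Type*} {l : List α} {i : ℕ} (h : i < l.length) :
    ∃ a, l[i]? = some a :=
  ⟨l[i], List.getElem?_eq_getElem h⟩

variable {E : Finset (Finset V)} {l : List (V ⊕ Finset V)}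

lemma IsListPath.isLeft_getElem? (h : IsListPath (Incident E) l) {a b : V ⊕ Finset V}
    (ha : l[0]? = some a) {i : ℕ} (hb : l[i]? = some b) :
    (i % 2 = 0 → b.isLeft = a.isLeft) ∧ (i % 2 = 1 → b.isLeft = !a.isLeft) := by
  induction i generalizing b with
  | zero =>
    obtain rfl : a = b := by simpa using ha.symm.trans hb
    simp
  | succ i ih =>
    obtain ⟨d, hd⟩ := exists_getElem?_of_lt (l := l) (i := i)
      (by have := lt_length_of_getElem? hb; omega)
    have h1 := h.rel_getElem? hd hb
    have h2 : b.isLeft = !d.isLeft := by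
      rcases d with d | d <;> rcases b with b | b <;> simp at h1 ⊢
    obtain ⟨h3, h4⟩ := ih hd
    refine ⟨fun hi => ?_, fun hi => ?_⟩
    · rw [h2, h4 (by omega), Bool.not_not]
    · rw [h2, h3 (by omega)]

lemma IsListPath.exists_inl_of_inl (h : IsListPath (Incident E) l) {x : V}
    (hx : l[0]? = some (Sum.inl x)) {i : ℕ} (hi : 2 * i < l.length) :
    ∃ v, l[2 * i]? = some (Sum.inl v) := by
  obtain ⟨b, hb⟩ := exists_getElem?_of_lt hi
  have := (h.isLeft_getElem? hx hb).1 (by omega)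
  rcases b with b | b
  · exact ⟨b, hb⟩
  · simp at this

lemma IsListPath.exists_inr_of_inl (h : IsListPath (Incident E) l) {x : V}
    (hx : l[0]? = some (Sum.inl x)) {i : ℕ} (hi : 2 * i + 1 < l.length) :
    ∃ e, l[2 * i + 1]? = some (Sum.inr e) := by
  obtain ⟨b, hb⟩ := exists_getElem?_of_lt hi
  have := (h.isLeft_getElem? hx hb).2 (by omega)
  rcases b with b | b
  · simp at this
  · exact ⟨b, hb⟩

lemma IsListPath.exists_inr_of_inr (h : IsListPath (Incident E) l) {x : Finset V}
    (hx : l[0]? = some (Sum.inr x)) {i : ℕ} (hi : 2 * i < l.length) :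
    ∃ e, l[2 * i]? = some (Sum.inr e) := by
  obtain ⟨b, hb⟩ := exists_getElem?_of_lt hi
  have := (h.isLeft_getElem? hx hb).1 (by omega)
  rcases b with b | b
  · simp at this
  · exact ⟨b, hb⟩

lemma IsListPath.exists_inl_of_inr (h : IsListPath (Incident E) l) {x : Finset V}
    (hx : l[0]? = some (Sum.inr x)) {i : ℕ} (hi : 2 * i + 1 < l.length) :
    ∃ v, l[2 * i + 1]? = some (Sum.inl v) := by
  obtain ⟨b, hb⟩ := exists_getElem?_of_lt hi
  have := (h.isLeft_getElem? hx hb).2 (by omega)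
  rcases b with b | b
  · exact ⟨b, hb⟩
  · simp at this

/-- A path in the incidence graph which starts at a vertex is a Berge path. -/
lemma hasBergePath_of_isListPath (h : IsListPath (Incident E) l) {x : V}
    (hx : l[0]? = some (Sum.inl x)) {k : ℕ} (hk : 2 * k + 1 ≤ l.length) : HasBergePath E k := by
  choose v hv using fun i : Fin (k + 1) => h.exists_inl_of_inl hx (i := i.1) (by omega)
  choose e he using fun i : Fin k => h.exists_inr_of_inl hx (i := i.1) (by omega)
  have hl : ∀ i : Fin k, e i ∈ E ∧ v i.castSucc ∈ e i := fun i =>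
    incident_inl_inr.1 (h.rel_getElem? (hv i.castSucc) (he i))
  refine ⟨v, e, ?_, ?_, fun i => (hl i).1, fun i => ⟨(hl i).2,
    (incident_inr_inl.1 (h.rel_getElem? (he i) (hv i.succ))).2⟩⟩
  · intro i j hij
    have := h.getElem?_inj (hv i) (hij ▸ hv j)
    exact Fin.ext (by omega)
  · intro i j hij
    have := h.getElem?_inj (he i) (hij ▸ he j)
    exact Fin.ext (by omega)

lemma card_le_of_forall_exists_getElem? {α β : Type*} {l : List α} {S : Finset β} {f : β → α}
    (hf : Function.Injective f) {m d : ℕ} (h : ∀ b ∈ S, ∃ i < m, l[2 * i + d]? = some (f b)) :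
    S.card ≤ m := by
  rw [← Finset.card_range m]
  refine Finset.card_le_card_of_forall_subsingleton (fun b i => l[2 * i + d]? = some (f b)) ?_ ?_
  · intro b hb
    obtain ⟨i, hi, hib⟩ := h b hb
    exact ⟨i, Finset.mem_range.2 hi, hib⟩
  · intro i _ b hb b' hb'
    exact hf (Option.some_injective _ (hb.2.symm.trans hb'.2))

lemma exists_odd_of_inl_mem (h : IsListPath (Incident E) l) {x : Finset V}
    (hx : l[0]? = some (Sum.inr x)) {m : ℕ} (hm : l.length ≤ 2 * m) {v : V} (hv : Sum.inl v ∈ l) :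
    ∃ i < m, l[2 * i + 1]? = some (Sum.inl v) := by
  obtain ⟨i, hi⟩ := List.mem_iff_getElem?.1 hv
  have h1 := lt_length_of_getElem? hi
  have h2 : i % 2 = 1 := by
    by_contra hodd
    have := (h.isLeft_getElem? hx hi).1 (by omega)
    simp at this
  refine ⟨i / 2, by omega, ?_⟩
  rwa [show 2 * (i / 2) + 1 = i by omega]

variable [DecidableEq V]

/-- The vertices on a list of vertices and hyperedges. -/
def vertexSet (l : List (V ⊕ Finset V)) : Finset V := l.toFinset.toLeft

/-- The hyperedges on a list of vertices and hyperedges. -/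
def edgeSet (l : List (V ⊕ Finset V)) : Finset (Finset V) := l.toFinset.toRight

@[simp] lemma mem_vertexSet {v : V} : v ∈ vertexSet l ↔ Sum.inl v ∈ l := by
  simp [vertexSet]

@[simp] lemma mem_edgeSet {e : Finset V} : e ∈ edgeSet l ↔ Sum.inr e ∈ l := by
  simp [edgeSet]

lemma card_vertexSet_le (h : IsListPath (Incident E) l) {x : V} (hx : l[0]? = some (Sum.inl x))
    {m : ℕ} (hm : l.length ≤ 2 * m) : (vertexSet l).card ≤ m := by
  refine card_le_of_forall_exists_getElem? (l := l) (d := 0) Sum.inl_injective fun v hv => ?_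
  obtain ⟨i, hi⟩ := List.mem_iff_getElem?.1 (mem_vertexSet.1 hv)
  have h1 := lt_length_of_getElem? hi
  have h2 : i % 2 = 0 := by
    by_contra hodd
    have := (h.isLeft_getElem? hx hi).2 (by omega)
    simp at this
  refine ⟨i / 2, by omega, ?_⟩
  rwa [show 2 * (i / 2) + 0 = i by omega]

lemma card_vertexSet_le_of_inr (h : IsListPath (Incident E) l) {x : Finset V}
    (hx : l[0]? = some (Sum.inr x)) {m : ℕ} (hm : l.length ≤ 2 * m) :
    (vertexSet l).card ≤ m :=
  card_le_of_forall_exists_getElem? (l := l) (d := 1) Sum.inl_injective fun _ hv =>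
    exists_odd_of_inl_mem h hx hm (mem_vertexSet.1 hv)

lemma card_edgeSet_le (h : IsListPath (Incident E) l) {x : V} (hx : l[0]? = some (Sum.inl x))
    {m : ℕ} (hm : l.length ≤ 2 * m + 1) : (edgeSet l).card ≤ m := by
  refine card_le_of_forall_exists_getElem? (l := l) (d := 1) Sum.inr_injective fun v hv => ?_
  obtain ⟨i, hi⟩ := List.mem_iff_getElem?.1 (mem_edgeSet.1 hv)
  have h1 := lt_length_of_getElem? hi
  have h2 : i % 2 = 1 := by
    by_contra hodd
    have := (h.isLeft_getElem? hx hi).1 (by omega)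
    simp at this
  refine ⟨i / 2, by omega, ?_⟩
  rwa [show 2 * (i / 2) + 1 = i by omega]

/-- If a longest path closes up to a cycle, then its vertices span a component. -/
lemma subset_vertexSet_of_closed {m : ℕ} (hl : IsListPath (Incident E) l) {x y : V}
    (hx : l[0]? = some (Sum.inl x)) (hlm : l.length = 2 * m + 1)
    (hy : l.getLast? = some (Sum.inl y)) {e : Finset V} (he : e ∈ E) (hxe : x ∈ e) (hye : y ∈ e)
    (hel : Sum.inr e ∉ l)
    (hmax : ∀ q v, IsListPath (Incident E) q → q[0]? = some (Sum.inl v) → q.length ≤ 2 * m + 2)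
    {g : Finset V} (hg : g ∈ E) (hgl : ¬ Disjoint g (vertexSet l)) : g ⊆ vertexSet l := by
  have hc : IsListPath (Incident E) (Sum.inr e :: l) :=
    hl.cons hx (incident_inr_inl.2 ⟨he, hxe⟩) hel
  have hlast : (Sum.inr e :: l).getLast? = some (Sum.inl y) := by
    rw [List.getLast?_cons, hy]
    rfl
  have hopen : ∀ a ∈ Sum.inr e :: l, ∃ q : List (V ⊕ Finset V), q.Perm (Sum.inr e :: l) ∧
      IsListPath (Incident E) q ∧ q[0]? = some a := fun a ha =>
    hc.exists_perm_head (a := Sum.inr e) (by simp) hlast (incident_inl_inr.2 ⟨he, hye⟩) ha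
  intro u hug
  by_contra hu
  rw [mem_vertexSet] at hu
  have hu' : Sum.inl u ∉ Sum.inr e :: l := by simpa using hu
  by_cases hgc : Sum.inr g ∈ Sum.inr e :: l
  · obtain ⟨q, hqp, hq, hq0⟩ := hopen _ hgc
    have := hmax (Sum.inl u :: q) u (hq.cons hq0 (incident_inl_inr.2 ⟨hg, hug⟩)
      (fun h => hu' (hqp.mem_iff.1 h))) (by simp)
    simp [hqp.length_eq, hlm] at this
  · obtain ⟨w, hwg, hwl⟩ := Finset.not_disjoint_iff.1 hgl
    obtain ⟨q, hqp, hq, hq0⟩ := hopen (Sum.inl w) (List.mem_cons_of_mem _ (mem_vertexSet.1 hwl))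
    have h1 := hq.cons hq0 (incident_inr_inl.2 ⟨hg, hwg⟩) (fun h => hgc (hqp.mem_iff.1 h))
    have := hmax (Sum.inl u :: Sum.inr g :: q) u (h1.cons (y := Sum.inr g) (by simp)
      (incident_inl_inr.2 ⟨hg, hug⟩) (by simpa using fun h => hu' (hqp.mem_iff.1 h))) (by simp)
    simp [hqp.length_eq, hlm] at this

/-- Either some component has at most `r + 1` vertices, or the ends of a longest path lie only in
hyperedges of the path. -/
lemma mem_of_end_of_longest {r m : ℕ} (hr : 2 ≤ r) (hmr : m ≤ r) (hE : ∀ e ∈ E, e.card = r)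
    (hcomp : ¬ ∃ C : Finset V, C.card ≤ r + 1 ∧ (∃ e ∈ E, ¬ Disjoint e C) ∧
      ∀ e ∈ E, ¬ Disjoint e C → e ⊆ C)
    (hmax : ∀ q v, IsListPath (Incident E) q → q[0]? = some (Sum.inl v) → q.length ≤ 2 * m + 2)
    (hl : IsListPath (Incident E) l) {x : V} (hx : l[0]? = some (Sum.inl x))
    (hlm : l.length = 2 * m + 1) {e : Finset V} (he : e ∈ E) (hxe : x ∈ e) : Sum.inr e ∈ l := by
  have hclosed : ∀ (q : List (V ⊕ Finset V)) (y : V) (g : Finset V), IsListPath (Incident E) q →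
      q[0]? = some (Sum.inl x) → q.length = 2 * m + 1 → q.getLast? = some (Sum.inl y) →
      g ∈ E → x ∈ g → y ∈ g → Sum.inr g ∈ q := by
    intro q y g hq hqx hqm hqy hg hxg hyg
    by_contra hgq
    refine hcomp ⟨vertexSet q, ?_, ⟨g, hg, Finset.not_disjoint_iff.2 ⟨x, hxg, ?_⟩⟩,
      fun f hf hfq => subset_vertexSet_of_closed hq hqx hqm hqy hg hxg hyg hgq hmax hf hfq⟩
    · exact card_vertexSet_le hq hqx (by omega)
    · exact mem_vertexSet.2 (List.mem_of_getElem? hqx)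
  by_contra hel
  obtain ⟨y, hy⟩ := hl.exists_inl_of_inl hx (i := m) (by omega)
  have hlast : l.getLast? = some (Sum.inl y) := by
    rw [List.getLast?_eq_getElem?, hlm]
    exact hy
  have hye : y ∉ e := fun hye => hel (hclosed l y e hl hx hlm hlast he hxe hye)
  have hepath := hl.cons hx (incident_inr_inl.2 ⟨he, hxe⟩) hel
  have hsub : e ⊆ (vertexSet l).erase y := by
    intro u hu
    refine Finset.mem_erase.2 ⟨fun h => hye (h ▸ hu), ?_⟩
    by_contra hul
    have := hmax (Sum.inl u :: Sum.inr e :: l) u (hepath.cons (y := Sum.inr e) (by simp)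
      (incident_inl_inr.2 ⟨he, hu⟩) (by simpa using hul)) (by simp)
    simp [hlm] at this
  have hycard : ((vertexSet l).erase y).card ≤ m := by
    rw [Finset.card_erase_of_mem (mem_vertexSet.2 (List.mem_of_getElem? hy))]
    have := card_vertexSet_le hl hx (m := m + 1) (by omega)
    omega
  have heq : e = (vertexSet l).erase y :=
    Finset.eq_of_subset_of_card_le hsub (by rw [hE e he]; omega)
  have hrm : r ≤ m := by
    rw [← hE e he, heq]
    exact hycard
  obtain ⟨h, hh⟩ := hl.exists_inr_of_inl hx (i := 0) (by omega)
  obtain ⟨w, hw⟩ := hl.exists_inl_of_inl hx (i := 1) (by omega)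
  obtain ⟨rest, rfl⟩ : ∃ rest, l = Sum.inl x :: Sum.inr h :: Sum.inl w :: rest := by
    match l, hx, hh, hw with
    | a :: b :: d :: rest, hx, hh, hw =>
      simp at hx hh hw
      exact ⟨rest, by rw [hx, hh, hw]⟩
  have hwy : w ≠ y := by
    rintro rfl
    have := hl.getElem?_inj hw hy
    omega
  have hwe : w ∈ e := by
    rw [heq]
    exact Finset.mem_erase.2 ⟨hwy, by simp⟩
  obtain ⟨hhE, hxh⟩ := incident_inl_inr.1 (hl.rel_getElem? hx hh)
  have htail : IsListPath (Incident E) (Sum.inl w :: rest) :=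
    ⟨hl.1.drop 2,
      hl.2.sublist (List.drop_sublist 2 (Sum.inl x :: Sum.inr h :: Sum.inl w :: rest))⟩
  have hq : IsListPath (Incident E) (Sum.inl x :: Sum.inr e :: Sum.inl w :: rest) := by
    have hnd := hl.2
    simp only [List.nodup_cons, List.mem_cons, not_or] at hnd hel
    refine (htail.cons (x := Sum.inr e) (y := Sum.inl w) (by simp)
      (incident_inr_inl.2 ⟨he, hwe⟩) ?_).cons (y := Sum.inr e) (by simp)
      (incident_inl_inr.2 ⟨he, hxe⟩) ?_
    · simp only [List.mem_cons, not_or]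
      tauto
    · simp only [List.mem_cons, not_or]
      exact ⟨by simp, by tauto⟩
  have hhq : Sum.inr h ∉ (Sum.inl x :: Sum.inr e :: Sum.inl w :: rest : List (V ⊕ Finset V)) := by
    have hnd := hl.2
    simp only [List.nodup_cons, List.mem_cons, not_or] at hnd hel ⊢
    exact ⟨by simp, fun hhe => hel.2.1 hhe.symm, by tauto⟩
  have hhsub : h ⊆ vertexSet (Sum.inl x :: Sum.inr h :: Sum.inl w :: rest) := by
    intro u hu
    by_contra hul
    have h1 := hq.cons (x := Sum.inr h) (y := Sum.inl x) (by simp)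
      (incident_inr_inl.2 ⟨hhE, hxh⟩) hhq
    have := hmax _ u (h1.cons (x := Sum.inl u) (y := Sum.inr h) (by simp)
      (incident_inl_inr.2 ⟨hhE, hu⟩) (by simpa using hul)) (by simp)
    simp at this hlm
    omega
  by_cases hyh : y ∈ h
  · refine hhq (hclosed _ y h hq (by simp) (by simpa using hlm) ?_ hhE hxh hyh)
    simpa [List.getLast?_cons] using hlast
  · have : h = e := by
      rw [heq]
      refine Finset.eq_of_subset_of_card_le (Finset.subset_erase.2 ⟨hhsub, hyh⟩) ?_
      rw [hE h hhE]
      omega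
    exact hel (by simp [this])

end Incidence

section Rotation

variable {V : Type*} {E : Finset (Finset V)}

/-- Rotations of a path which starts with a hyperedge `h` produce at least `h.card` vertices, all
of which are ends of longest paths on the same hyperedges. -/
lemma card_le_card_ends [DecidableEq V] {l : List (V ⊕ Finset V)} {m : ℕ}
    (hl : IsListPath (Incident E) l) (hlm : l.length = 2 * m) {h : Finset V}
    (h0 : l[0]? = some (Sum.inr h)) {S : Finset V}
    (hS : ∀ (q : List (V ⊕ Finset V)) (x : V), IsListPath (Incident E) q → q.length = 2 * m + 1 →
      q[0]? = some (Sum.inl x) → (∀ e, Sum.inr e ∈ q → Sum.inr e ∈ l) → x ∈ S)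
    {z : V} (hz : l[2 * m - 1]? = some (Sum.inl z)) (hzS : z ∈ S)
    (hout : ∀ j e v, j ≠ 0 → l[2 * j]? = some (Sum.inr e) → l[2 * j + 1]? = some (Sum.inl v) →
      v ∈ h → ∃ u ∈ e, Sum.inl u ∉ l) : h.card ≤ S.card := by
  have hm : 0 < m := by
    have := lt_length_of_getElem? h0
    omega
  have hedge : ∀ {j : ℕ} {e : Finset V}, l[2 * j]? = some (Sum.inr e) → e ∈ E := by
    intro j e he
    obtain ⟨v, hv⟩ := hl.exists_inl_of_inr h0 (i := j)
      (by have := lt_length_of_getElem? he; omega)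
    exact (incident_inr_inl.1 (hl.rel_getElem? he hv)).1
  have hhE : h ∈ E := hedge (j := 0) h0
  -- rotating at a vertex of `h` and prepending a vertex outside the path
  have hrot : ∀ (j : ℕ) (e : Finset V) (v u : V), l[2 * j]? = some (Sum.inr e) →
      l[2 * j + 1]? = some (Sum.inl v) → v ∈ h → u ∈ e → Sum.inl u ∉ l →
      IsListPath (Incident E) (Sum.inl u :: reversePrefix l (2 * j + 1)) := by
    intro j e v u he hv hvh hue hul
    refine (hl.reversePrefix (incident_symm E) h0 hv (incident_inr_inl.2 ⟨hhE, hvh⟩)).cons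
      (y := Sum.inr e) ?_ (incident_inl_inr.2 ⟨hedge he, hue⟩) ?_
    · rwa [getElem?_zero_reversePrefix l (lt_length_of_getElem? he)]
    · exact fun hu => hul ((reversePrefix_perm l _).mem_iff.1 hu)
  have hend : ∀ (j : ℕ) (e : Finset V) (v u : V), l[2 * j]? = some (Sum.inr e) →
      l[2 * j + 1]? = some (Sum.inl v) → v ∈ h → u ∈ e → Sum.inl u ∉ l → u ∈ S := by
    intro j e v u he hv hvh hue hul
    refine hS _ u (hrot j e v u he hv hvh hue hul) ?_ (by simp) ?_
    · rw [List.length_cons, (reversePrefix_perm l _).length_eq, hlm]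
    · intro g hg
      exact (reversePrefix_perm l _).mem_iff.1 (by simpa using hg)
  -- a second rotation
  have hend' : ∀ (i j : ℕ) (e g : Finset V) (v u w : V), i < j → l[2 * i]? = some (Sum.inr e) →
      l[2 * i + 1]? = some (Sum.inl v) → v ∈ h → u ∈ e → Sum.inl u ∉ l →
      l[2 * j]? = some (Sum.inr g) → u ∈ g → l[2 * j - 1]? = some (Sum.inl w) → w ∈ S := by
    intro i j e g v u w hij he hv hvh hue hul hg hug hw
    have hp := hrot i e v u he hv hvh hue hul
    have hil := lt_length_of_getElem? hv
    have hjl := lt_length_of_getElem? hg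
    have hlen : (reversePrefix l (2 * i + 1)).length = l.length :=
      (reversePrefix_perm l _).length_eq
    have hg' : (Sum.inl u :: reversePrefix l (2 * i + 1))[2 * j + 1]? = some (Sum.inr g) := by
      rw [List.getElem?_cons_succ, getElem?_reversePrefix_of_le l (by omega) (by omega), hg]
    have hperm := reversePrefix_perm (Sum.inl u :: reversePrefix l (2 * i + 1)) (2 * j + 1)
    refine hS _ w (hp.reversePrefix (incident_symm E) (x := Sum.inl u) (by simp) hg'
      (incident_inl_inr.2 ⟨hedge hg, hug⟩)) ?_ ?_ ?_
    · rw [hperm.length_eq, List.length_cons, hlen, hlm]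
    · rw [getElem?_zero_reversePrefix _ (by simp [hlen]; omega),
        show 2 * j = 2 * j - 1 + 1 by omega, List.getElem?_cons_succ,
        getElem?_reversePrefix_of_le l (by omega) (by omega), hw]
    · intro f hf
      exact (reversePrefix_perm l _).mem_iff.1 (by simpa using hperm.mem_iff.1 hf)
  let T : V → V → Prop := fun x s =>
    (Sum.inl x ∉ l ∧ s = x) ∨ (l[1]? = some (Sum.inl x) ∧ s = z) ∨
    (∃ j, 1 ≤ j ∧ l[2 * j + 1]? = some (Sum.inl x) ∧ l[2 * j - 1]? = some (Sum.inl s)) ∨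
    (∃ j e, 1 ≤ j ∧ l[2 * j + 1]? = some (Sum.inl x) ∧ l[2 * j]? = some (Sum.inr e) ∧ s ∈ e ∧
      Sum.inl s ∉ l ∧ ∀ i g v, i < j → l[2 * i]? = some (Sum.inr g) →
        l[2 * i + 1]? = some (Sum.inl v) → v ∈ h → s ∉ g)
  have hTex : ∀ x ∈ h, ∃ s ∈ S, T x s := by
    intro x hx
    obtain ⟨v, hv⟩ := hl.exists_inl_of_inr h0 (i := 0) (by omega)
    have hvh : v ∈ h := (incident_inr_inl.1 (hl.rel_getElem? h0 hv)).2
    by_cases hxl : Sum.inl x ∈ l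
    · obtain ⟨j, hjm, hj⟩ := exists_odd_of_inl_mem hl h0 hlm.le hxl
      rcases Nat.eq_zero_or_pos j with rfl | hj0
      · exact ⟨z, hzS, Or.inr (Or.inl ⟨hj, rfl⟩)⟩
      obtain ⟨w, hw⟩ := hl.exists_inl_of_inr h0 (i := j - 1) (by omega)
      rw [show 2 * (j - 1) + 1 = 2 * j - 1 by omega] at hw
      by_cases hwS : w ∈ S
      · exact ⟨w, hwS, Or.inr (Or.inr (Or.inl ⟨j, hj0, hj, hw⟩))⟩
      obtain ⟨e, he⟩ := hl.exists_inr_of_inr h0 (i := j) (by omega)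
      obtain ⟨u, hue, hul⟩ := hout j e x (by omega) he hj hx
      refine ⟨u, hend j e x u he hj hx hue hul,
        Or.inr (Or.inr (Or.inr ⟨j, e, hj0, hj, he, hue, hul, ?_⟩))⟩
      intro i g v hij hg hv hvh hug
      exact hwS (hend' i j g e v u w hij hg hv hvh hug hul he hue hw)
    · exact ⟨x, hend 0 h v x h0 hv hvh hx hxl, Or.inl ⟨hxl, rfl⟩⟩
  have hmem : ∀ {i : ℕ} {a : V}, l[i]? = some (Sum.inl a) → Sum.inl a ∈ l :=
    fun hi => List.mem_of_getElem? hi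
  have hinl : ∀ {i : ℕ} {a b : V}, l[i]? = some (Sum.inl a) → l[i]? = some (Sum.inl b) → a = b :=
    fun ha hb => Sum.inl_injective (Option.some_injective _ (ha.symm.trans hb))
  -- it suffices to compare pairs up to symmetry
  have hTinj : ∀ s x, x ∈ h → T x s → ∀ y, y ∈ h → T y s → x = y := by
    obtain ⟨v, hv⟩ := hl.exists_inl_of_inr h0 (i := 0) (by omega)
    have hvh : v ∈ h := (incident_inr_inl.1 (hl.rel_getElem? h0 hv)).2
    intro s x hx hxs y hy hys
    rcases hxs with ⟨hxl, rfl⟩ | ⟨hx1, rfl⟩ | ⟨j, hj, hxj, hsj⟩ |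
      ⟨j, e, hj, hxj, he, hse, hsl, hmin⟩
    · rcases hys with ⟨hyl, rfl⟩ | ⟨hy1, rfl⟩ | ⟨i, hi, hyi, hsi⟩ |
        ⟨i, g, hi, hyi, hg, hsg, hsl', hmin'⟩
      · rfl
      · exact absurd (hmem hz) hxl
      · exact absurd (hmem hsi) hxl
      · exact absurd hx (hmin' 0 h v (by omega) h0 hv hvh)
    · rcases hys with ⟨hyl, rfl⟩ | ⟨hy1, -⟩ | ⟨i, hi, hyi, hsi⟩ |
        ⟨i, g, hi, hyi, hg, hsg, hsl', hmin'⟩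
      · exact absurd (hmem hz) hyl
      · exact hinl hx1 hy1
      · have h1 := hl.getElem?_inj hz hsi
        have h2 := lt_length_of_getElem? hyi
        omega
      · exact absurd (hmem hz) hsl'
    · rcases hys with ⟨hyl, rfl⟩ | ⟨hy1, rfl⟩ | ⟨i, hi, hyi, hsi⟩ |
        ⟨i, g, hi, hyi, hg, hsg, hsl', hmin'⟩
      · exact absurd (hmem hsj) hyl
      · have h1 := hl.getElem?_inj hz hsj
        have h2 := lt_length_of_getElem? hxj
        omega
      · have h1 := hl.getElem?_inj hsj hsi
        obtain rfl : i = j := by omega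
        exact hinl hxj hyi
      · exact absurd (hmem hsj) hsl'
    · rcases hys with ⟨hyl, rfl⟩ | ⟨hy1, rfl⟩ | ⟨i, hi, hyi, hsi⟩ |
        ⟨i, g, hi, hyi, hg, hsg, hsl', hmin'⟩
      · exact absurd hy (hmin 0 h v (by omega) h0 hv hvh)
      · exact absurd (hmem hz) hsl
      · exact absurd (hmem hsi) hsl
      · rcases lt_trichotomy i j with hij | rfl | hij
        · exact absurd hsg (hmin i g y hij hg hyi hy)
        · exact hinl hxj hyi
        · exact absurd hse (hmin' j e x hij he hxj hx)
  exact Finset.card_le_card_of_forall_subsingleton T hTex fun s _ x hx y hy =>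
    hTinj s x hx.1 hx.2 y hy.1 hy.2

/-- In an `r`-uniform hypergraph without Berge paths of length `r + 1`, some nonempty set of
vertices meets at most as many hyperedges as it has vertices. -/
lemma exists_card_filter_not_disjoint_le [DecidableEq V] {r : ℕ} (hr : 2 ≤ r)
    (hE : ∀ e ∈ E, e.card = r) (hno : ¬ HasBergePath E (r + 1)) (hne : E.Nonempty) :
    ∃ S ⊆ E.biUnion id, S.Nonempty ∧ (E.filter fun e => ¬ Disjoint e S).card ≤ S.card := by
  classical
  by_cases hcomp : ∃ C : Finset V, C.card ≤ r + 1 ∧ (∃ e ∈ E, ¬ Disjoint e C) ∧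
      ∀ e ∈ E, ¬ Disjoint e C → e ⊆ C
  · obtain ⟨C, hC, ⟨e, he, heC⟩, hsub⟩ := hcomp
    refine ⟨C ∩ E.biUnion id, Finset.inter_subset_right, ?_, ?_⟩
    · obtain ⟨v, hve, hvC⟩ := Finset.not_disjoint_iff.1 heC
      exact ⟨v, Finset.mem_inter.2 ⟨hvC, Finset.mem_biUnion.2 ⟨e, he, hve⟩⟩⟩
    · have h1 : (E.filter fun e => ¬ Disjoint e (C ∩ E.biUnion id)) ⊆
          (C ∩ E.biUnion id).powersetCard r := by
        intro g hg
        obtain ⟨hgE, hgC⟩ := Finset.mem_filter.1 hg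
        refine Finset.mem_powersetCard.2 ⟨Finset.subset_inter ?_ ?_, hE g hgE⟩
        · exact hsub g hgE fun hd =>
            hgC (Finset.disjoint_of_subset_right Finset.inter_subset_left hd)
        · exact fun v hv => Finset.mem_biUnion.2 ⟨g, hgE, hv⟩
      refine (Finset.card_le_card h1).trans ?_
      rw [Finset.card_powersetCard]
      have h2 : (C ∩ E.biUnion id).card ≤ r + 1 :=
        (Finset.card_le_card Finset.inter_subset_left).trans hC
      rcases Nat.lt_or_ge (C ∩ E.biUnion id).card r with h | h
      · rw [Nat.choose_eq_zero_of_lt h]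
        exact Nat.zero_le _
      · rcases Nat.lt_or_ge r (C ∩ E.biUnion id).card with h' | h'
        · rw [show (C ∩ E.biUnion id).card = r + 1 by omega]
          simp
        · rw [show (C ∩ E.biUnion id).card = r by omega]
          simp
          omega
  obtain ⟨e₀, he₀⟩ := hne
  obtain ⟨v₀, w₀, hv₀, hw₀, hvw⟩ := Finset.one_lt_card_iff.1 (show 1 < e₀.card by
    rw [hE e₀ he₀]; omega)
  obtain ⟨m, ⟨p, x₀, hp, hx₀, hpm⟩, hmax⟩ := exists_greatest_of_bounded
    (P := fun n => ∃ (q : List (V ⊕ Finset V)) (x : V), IsListPath (Incident E) q ∧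
      q[0]? = some (Sum.inl x) ∧ q.length = 2 * n + 1) (k := r)
    ⟨0, [Sum.inl v₀], v₀, ⟨List.isChain_singleton _, List.nodup_singleton _⟩, rfl, rfl⟩
    (by
      rintro n ⟨q, x, hq, hx, hqn⟩
      by_contra! hn
      exact hno (hasBergePath_of_isListPath hq hx (by omega)))
  have hm1 : 1 ≤ m := hmax 1 ⟨[Sum.inl v₀, Sum.inr e₀, Sum.inl w₀], v₀,
    ⟨by simp [he₀, hv₀, hw₀], by simp [hvw]⟩, rfl, rfl⟩
  have hmr : m ≤ r := by
    by_contra! hn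
    exact hno (hasBergePath_of_isListPath hp hx₀ (by omega))
  have hmax' : ∀ q v, IsListPath (Incident E) q → q[0]? = some (Sum.inl v) →
      q.length ≤ 2 * m + 2 := by
    intro q v hq hv
    by_contra! hlt
    have := hmax (m + 1) ⟨q.take (2 * (m + 1) + 1), v,
      ⟨hq.1.take _, hq.2.sublist (List.take_sublist _ _)⟩,
        by rwa [List.getElem?_take_of_lt (by omega)], by
        rw [List.length_take]; omega⟩
    omega
  let S : Finset V := (E.biUnion id).filter fun x => ∃ q : List (V ⊕ Finset V),
    IsListPath (Incident E) q ∧ q[0]? = some (Sum.inl x) ∧ q.length = 2 * m + 1 ∧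
      ∀ e, Sum.inr e ∈ q → Sum.inr e ∈ p
  have hS : ∀ (q : List (V ⊕ Finset V)) (x : V), IsListPath (Incident E) q →
      q.length = 2 * m + 1 → q[0]? = some (Sum.inl x) →
      (∀ e, Sum.inr e ∈ q → Sum.inr e ∈ p) → x ∈ S := by
    intro q x hq hqm hx hqp
    refine Finset.mem_filter.2 ⟨?_, q, hq, hx, hqm, hqp⟩
    obtain ⟨e, he⟩ := hq.exists_inr_of_inl hx (i := 0) (by omega)
    obtain ⟨h1, h2⟩ := incident_inl_inr.1 (hq.rel_getElem? hx he)
    exact Finset.mem_biUnion.2 ⟨e, h1, h2⟩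
  have hNS : (E.filter fun e => ¬ Disjoint e S).card ≤ m := by
    refine le_trans (Finset.card_le_card (t := edgeSet p) ?_) (card_edgeSet_le hp hx₀ hpm.le)
    intro e he
    obtain ⟨heE, heS⟩ := Finset.mem_filter.1 he
    obtain ⟨x, hxe, hxS⟩ := Finset.not_disjoint_iff.1 heS
    obtain ⟨-, q, hq, hqx, hqm, hqp⟩ := Finset.mem_filter.1 hxS
    exact mem_edgeSet.2 (hqp e (mem_of_end_of_longest hr hmr hE hcomp hmax' hq hqx hqm heE hxe))
  refine ⟨S, Finset.filter_subset _ _, ⟨x₀, hS p x₀ hp hpm hx₀ fun _ h => h⟩,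
    hNS.trans (hmr.trans ?_)⟩
  obtain ⟨l, rfl⟩ : ∃ l, p = Sum.inl x₀ :: l := by
    match p, hx₀ with
    | a :: l, hx₀ =>
      simp at hx₀
      exact ⟨l, by rw [hx₀]⟩
  have hl : IsListPath (Incident E) l := ⟨hp.1.tail, (List.nodup_cons.1 hp.2).2⟩
  have hlm : l.length = 2 * m := by simpa using hpm
  have hlp : ∀ e, Sum.inr e ∈ l → (Sum.inr e : V ⊕ Finset V) ∈ Sum.inl x₀ :: l :=
    fun e he => List.mem_cons_of_mem _ he
  obtain ⟨h, hh⟩ := hp.exists_inr_of_inl hx₀ (i := 0) (by omega)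
  have hl0 : l[0]? = some (Sum.inr h) := by simpa using hh
  have hhE := (incident_inl_inr.1 (hp.rel_getElem? hx₀ hh)).1
  obtain ⟨z, hz⟩ := hl.exists_inl_of_inr hl0 (i := m - 1) (by omega)
  rw [show 2 * (m - 1) + 1 = 2 * m - 1 by omega] at hz
  have hzS : z ∈ S := by
    refine hS _ z (hp.reverse (incident_symm E)) (by simpa using hpm) ?_ (by simp)
    rw [List.getElem?_reverse (by omega), hpm,
      show 2 * m + 1 - 1 - 0 = 2 * m - 1 + 1 by omega, List.getElem?_cons_succ, hz]
  by_cases hout : ∀ j e v, j ≠ 0 → l[2 * j]? = some (Sum.inr e) →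
      l[2 * j + 1]? = some (Sum.inl v) → v ∈ h → ∃ u ∈ e, Sum.inl u ∉ l
  · rw [← hE h hhE]
    exact card_le_card_ends hl hlm hl0
      (fun q x hq hqm hqx hql => hS q x hq hqm hqx fun e he => hlp e (hql e he)) hz hzS hout
  push Not at hout
  obtain ⟨j, g, v, hj, hg, hv, hvh, hgl⟩ := hout
  have hjl := lt_length_of_getElem? hv
  have hgE : g ∈ E := (incident_inr_inl.1 (hl.rel_getElem? hg hv)).1
  have hperm := reversePrefix_perm l (2 * j + 1)
  have hrot := hl.reversePrefix (incident_symm E) hl0 hv (incident_inr_inl.2 ⟨hhE, hvh⟩)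
  have hlen : (reversePrefix l (2 * j + 1)).length = 2 * m := by rw [hperm.length_eq, hlm]
  have hrot0 : (reversePrefix l (2 * j + 1))[0]? = some (Sum.inr g) := by
    rw [getElem?_zero_reversePrefix l (by omega), hg]
  have hfull : ∀ f ∈ E, (∀ u ∈ f, Sum.inl u ∈ l) → f = vertexSet l := by
    intro f hf hfl
    refine Finset.eq_of_subset_of_card_le (fun u hu => mem_vertexSet.2 (hfl u hu)) ?_
    rw [hE f hf]
    exact (card_vertexSet_le_of_inr hl hl0 hlm.le).trans hmr
  rw [← hE g hgE]
  refine card_le_card_ends hrot hlen hrot0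
    (fun q x hq hqm hqx hql => hS q x hq hqm hqx fun e he =>
      hlp e (hperm.mem_iff.1 (hql e he))) (z := z) ?_ hzS ?_
  · rw [getElem?_reversePrefix_of_le l (by omega) (by omega), hz]
  · intro i f w hi hf hw _
    by_contra! hfl
    have hfE : f ∈ E := (incident_inr_inl.1 (hrot.rel_getElem? hf hw)).1
    have hfg : f = g := by
      rw [hfull f hfE fun u hu => hperm.mem_iff.1 (hfl u hu), hfull g hgE hgl]
    have := hrot.getElem?_inj hf (hfg ▸ hrot0)
    omega

/-- The upper bound for `k = r + 1`. -/
lemma card_le_card_biUnion_of_not_hasBergePath [DecidableEq V] {r : ℕ} (hr : 2 ≤ r) :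
    ∀ E : Finset (Finset V), (∀ e ∈ E, e.card = r) → ¬ HasBergePath E (r + 1) →
      E.card ≤ (E.biUnion id).card := by
  intro E
  induction E using Finset.strongInduction with
  | H E ih =>
  intro hE hno
  rcases E.eq_empty_or_nonempty with rfl | hne
  · simp
  obtain ⟨S, hSE, ⟨x, hx⟩, hS⟩ := exists_card_filter_not_disjoint_le hr hE hno hne
  have hsub : E.filter (fun e => Disjoint e S) ⊂ E := by
    obtain ⟨e, he, hxe⟩ := Finset.mem_biUnion.1 (hSE hx)
    exact Finset.filter_ssubset.2 ⟨e, he, Finset.not_disjoint_iff.2 ⟨x, hxe, hx⟩⟩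
  have h1 := ih _ hsub (fun e he => hE e (hsub.subset he)) (by
    rintro ⟨v, h, hv, hh, hhE, hvh⟩
    exact hno ⟨v, h, hv, hh, fun i => hsub.subset (hhE i), hvh⟩)
  have h2 : (E.filter (fun e => Disjoint e S)).biUnion id ⊆ E.biUnion id \ S := by
    intro v hv
    obtain ⟨e, he, hve⟩ := Finset.mem_biUnion.1 hv
    obtain ⟨heE, heS⟩ := Finset.mem_filter.1 he
    exact Finset.mem_sdiff.2 ⟨Finset.mem_biUnion.2 ⟨e, heE, hve⟩,
      Finset.disjoint_left.1 heS hve⟩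
  have h3 := Finset.card_le_card h2
  have h4 := Finset.card_sdiff_add_card_eq_card hSE
  have h5 := Finset.card_filter_add_card_filter_not (s := E) (fun e => Disjoint e S)
  omega

end Rotation

section DisjointCliques

/-- The `b`-th of `q` consecutive blocks of `k` vertices. -/
def vertexBlock (q k : ℕ) (b : Fin q) : Finset (Fin (q * k)) :=
  (Finset.univ.map (.sectR b (Fin k))).map finProdFinEquiv.toEmbedding

theorem card_vertexBlock (q k : ℕ) (b : Fin q) : (vertexBlock q k b).card = k := by
  simp [vertexBlock]

theorem mem_vertexBlock {q k : ℕ} {b : Fin q} {x : Fin (q * k)} :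
    x ∈ vertexBlock q k b ↔ (finProdFinEquiv.symm x).1 = b := by
  rw [vertexBlock, Finset.mem_map_equiv]
  simp only [Finset.mem_map, Finset.mem_univ, true_and, Function.Embedding.sectR_apply,
    Prod.ext_iff]
  exact ⟨fun ⟨_, h, _⟩ => h.symm, fun h => ⟨_, h.symm, rfl⟩⟩

/-- The disjoint union of `q` complete `r`-graphs on `k` vertices each. -/
def disjointCliques (q k r : ℕ) : Finset (Finset (Fin (q * k))) :=
  Finset.univ.biUnion fun b => (vertexBlock q k b).powersetCard r

theorem mem_disjointCliques {q k r : ℕ} {e : Finset (Fin (q * k))} :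
    e ∈ disjointCliques q k r ↔ ∃ b, e ⊆ vertexBlock q k b ∧ e.card = r := by
  simp [disjointCliques, Finset.mem_powersetCard]

theorem card_disjointCliques (q k : ℕ) {r : ℕ} (hr : 0 < r) :
    (disjointCliques q k r).card = q * k.choose r := by
  rw [disjointCliques, Finset.card_biUnion]
  · simp [card_vertexBlock]
  · intro b _ c _ hbc
    refine Finset.disjoint_left.2 fun e hb hc => hbc ?_
    rw [Finset.mem_powersetCard] at hb hc
    obtain ⟨x, hx⟩ := Finset.card_pos.1 (hb.2 ▸ hr)
    exact (mem_vertexBlock.1 (hb.1 hx)).symm.trans (mem_vertexBlock.1 (hc.1 hx))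

theorem not_hasBergePath_disjointCliques (q k r : ℕ) :
    ¬ HasBergePath (disjointCliques q k r) k := by
  rintro ⟨v, h, hv, -, hE, hinc⟩
  have hstep (i : Fin (k + 1)) :
      (finProdFinEquiv.symm (v i)).1 = (finProdFinEquiv.symm (v 0)).1 := by
    induction i using Fin.induction with
    | zero => rfl
    | succ i ih =>
      obtain ⟨b, hb, -⟩ := mem_disjointCliques.1 (hE i)
      rw [← ih, mem_vertexBlock.1 (hb (hinc i).1), mem_vertexBlock.1 (hb (hinc i).2)]
  have hcard := Finset.card_le_card_of_injOn (s := Finset.univ) v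
    (fun i _ => mem_vertexBlock.2 (hstep i)) hv.injOn
  rw [card_vertexBlock, Finset.card_univ, Fintype.card_fin] at hcard
  omega

end DisjointCliques

/-- If `k ≥ r+1 > 3`, then every `n`-vertex `r`-uniform hypergraph without a Berge
path of length `k` has at most `(n/k)·C(k,r)` hyperedges, and if `k ∣ n` this bound
is attained. -/
theorem berge_path_turan_large_k (r k : ℕ) (hk : r + 1 ≤ k) (hr : 3 < r + 1) :
    (∀ (n : ℕ) (E : Finset (Finset (Fin n))), (∀ e ∈ E, e.card = r) →
        ¬ HasBergePath E k → (E.card : ℚ) ≤ (n : ℚ) / (k : ℚ) * (Nat.choose k r : ℚ)) ∧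
    (∀ n : ℕ, k ∣ n → ∃ E : Finset (Finset (Fin n)),
        (∀ e ∈ E, e.card = r) ∧ ¬ HasBergePath E k ∧
        (E.card : ℚ) = (n : ℚ) / (k : ℚ) * (Nat.choose k r : ℚ)) := by
  have hk0 : (0 : ℚ) < k := by exact_mod_cast (by omega : 0 < k)
  refine ⟨fun n E hE hno => ?_, ?_⟩
  · rw [div_mul_eq_mul_div, le_div_iff₀ hk0]
    norm_cast
    rcases hk.eq_or_lt with rfl | hk'
    · rw [Nat.choose_succ_self_right]
      refine Nat.mul_le_mul_right _ ((card_le_card_biUnion_of_not_hasBergePath (by omega) E hE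
        hno).trans ?_)
      simpa using Finset.card_le_univ (E.biUnion id)
    · have hmain := mul_card_le_of_not_hasBergePath (by omega) hk' hE hno
      rw [Fintype.card_fin] at hmain
      have hchoose : k * (k - 1).choose (r - 1) = k.choose r * r := by
        obtain ⟨k, rfl⟩ := Nat.exists_eq_add_of_lt (show 0 < k by omega)
        obtain ⟨r, rfl⟩ := Nat.exists_eq_add_of_lt (show 0 < r by omega)
        simpa using Nat.add_one_mul_choose_eq k r
      refine Nat.le_of_mul_le_mul_left ?_ (show 0 < r by omega)
      calc r * (E.card * k) = (r * E.card) * k := by ring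
        _ ≤ (n * (k - 1).choose (r - 1)) * k := Nat.mul_le_mul_right _ hmain
        _ = n * (k * (k - 1).choose (r - 1)) := by ring
        _ = r * (n * k.choose r) := by rw [hchoose]; ring
  · rintro n ⟨q, rfl⟩
    rw [mul_comm k q]
    refine ⟨disjointCliques q k r, fun e he => ?_, not_hasBergePath_disjointCliques q k r, ?_⟩
    · exact (mem_disjointCliques.1 he).choose_spec.2
    · rw [card_disjointCliques q k (by omega), Nat.cast_mul, Nat.cast_mul,
        mul_div_cancel_right₀ _ hk0.ne']
end

section
/- If r ≥ k > 2, then every n-vertex r-uniform hypergraph containing no Berge path of length k has at most n(k−1)/(r+1) hyperedges; moreover, if r+1 divides n, then there exists an n-vertex r-uniform hypergraph with exactly n(k−1)/(r+1) hyperedges and no Berge path of length k. -/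
namespace BergePathTuran

open Finset

/-- A Berge path from `a` to `b` whose defining vertices form `U` and whose hyperedges form `H`. -/
inductive PathOn {V : Type*} [DecidableEq V] : V → V → Finset V → Finset (Finset V) → Prop
  | nil (a : V) : PathOn a a {a} ∅
  | cons {a b c : V} {U : Finset V} {H : Finset (Finset V)} {h : Finset V}
      (ha : a ∉ U) (hh : h ∉ H) (hah : a ∈ h) (hbh : b ∈ h) (p : PathOn b c U H) :
      PathOn a c (insert a U) (insert h H)

variable {V : Type*} [DecidableEq V]

namespace PathOn

variable {a b c d x : V} {U U' : Finset V} {H H' : Finset (Finset V)} {h : Finset V}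

lemma card_eq (p : PathOn a b U H) : #U = #H + 1 := by
  induction p with
  | nil a => simp
  | cons ha hh _ _ _ ih => rw [card_insert_of_notMem ha, card_insert_of_notMem hh, ih]

lemma left_mem (p : PathOn a b U H) : a ∈ U := by
  cases p <;> simp

lemma right_mem (p : PathOn a b U H) : b ∈ U := by
  induction p with
  | nil a => simp
  | cons _ _ _ _ _ ih => exact mem_insert_of_mem ih

/-- Two disjoint paths joined by a new hyperedge form a path. -/
lemma join (p : PathOn a b U H) (q : PathOn c d U' H') (hU : Disjoint U U')
    (hH : Disjoint H H') (h1 : h ∉ H) (h2 : h ∉ H') (hb : b ∈ h) (hc : c ∈ h) :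
    PathOn a d (U ∪ U') (insert h (H ∪ H')) := by
  induction p with
  | nil a =>
    simp only [disjoint_singleton_left] at hU
    simpa [← insert_eq] using q.cons hU h2 hb hc
  | @cons a e b U H g ha hg hag heg p ih =>
    simp only [disjoint_insert_left] at hU hH
    simp only [mem_insert, not_or] at h1
    have := ih hU.2 hH.2 h1.2 hb
    rw [insert_union, insert_union, insert_comm]
    refine this.cons ?_ ?_ hag heg
    · simp [ha, hU.1]
    · simp [hg, hH.1, Ne.symm h1.1]

/-- A path can be extended at its right end. -/
lemma snoc (p : PathOn a b U H) (hx : x ∉ U) (hh : h ∉ H) (hb : b ∈ h) (hxh : x ∈ h) :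
    PathOn a x (insert x U) (insert h H) := by
  have := p.join (nil x) (h := h) (by simpa using hx) (by simp) hh (by simp) hb hxh
  simpa [union_comm U, ← insert_eq] using this

lemma reverse (p : PathOn a b U H) : PathOn b a U H := by
  induction p with
  | nil a => exact nil a
  | cons ha hh hah hbh _ ih => exact ih.snoc ha hh hbh hah

end PathOn

/-- The sequences `v 0, …, v n` and `h 0, …, h (n - 1)` form a Berge path. -/
structure IsPathSeq (n : ℕ) (v : ℕ → V) (h : ℕ → Finset V) : Prop where
  injOn_vertex : Set.InjOn v (range (n + 1))
  injOn_edge : Set.InjOn h (range n)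
  left_mem : ∀ i < n, v i ∈ h i
  right_mem : ∀ i < n, v (i + 1) ∈ h i

lemma PathOn.exists_isPathSeq {a b : V} {U : Finset V} {H : Finset (Finset V)}
    (p : PathOn a b U H) : ∃ v h, IsPathSeq #H v h ∧ v 0 = a ∧ v #H = b ∧
      (range (#H + 1)).image v = U ∧ (range #H).image h = H := by
  induction p with
  | nil a =>
    exact ⟨fun _ => a, fun _ => ∅, ⟨by intro; simp_all, by intro; simp_all, by simp, by simp⟩,
      rfl, rfl, by simp, by simp⟩
  | @cons a b c U H g ha hg hag hbg p ih =>
    obtain ⟨v, h, hs, h0, hl, hU, hH⟩ := ih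
    rw [card_insert_of_notMem hg]
    have hv : ∀ i ≤ #H, v i ∈ U := fun i hi => by
      exact hU.subset (mem_image_of_mem _ (by simp; omega))
    have hh : ∀ i < #H, h i ∈ H := fun i hi => by
      exact hH.subset (mem_image_of_mem _ (by simpa using hi))
    refine ⟨fun i => Nat.casesOn i a v, fun i => Nat.casesOn i g h,
      ⟨?_, ?_, ?_, ?_⟩, rfl, hl, ?_, ?_⟩
    · rintro (_ | i) hi (_ | j) hj hij
      · rfl
      · simp only [coe_range, Set.mem_Iio] at hj hij
        exact absurd (Set.mem_of_eq_of_mem (s := U) hij (hv j (by omega))) ha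
      · simp only [coe_range, Set.mem_Iio] at hi hij
        exact absurd (Set.mem_of_eq_of_mem (s := U) hij.symm (hv i (by omega))) ha
      · simp only [coe_range, Set.mem_Iio] at hi hj
        rw [hs.injOn_vertex (by simp; omega) (by simp; omega) hij]
    · rintro (_ | i) hi (_ | j) hj hij
      · rfl
      · simp only [coe_range, Set.mem_Iio] at hj hij
        exact absurd (Set.mem_of_eq_of_mem (s := H) hij (hh j (by omega))) hg
      · simp only [coe_range, Set.mem_Iio] at hi hij
        exact absurd (Set.mem_of_eq_of_mem (s := H) hij.symm (hh i (by omega))) hg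
      · simp only [coe_range, Set.mem_Iio] at hi hj
        rw [hs.injOn_edge (by simp; omega) (by simp; omega) hij]
    · rintro (_ | i) hi
      · exact hag
      · exact hs.left_mem i (by omega)
    · rintro (_ | i) hi
      · simpa [h0] using hbg
      · exact hs.right_mem i (by omega)
    · rw [range_add_one', image_insert, map_eq_image, image_image, ← hU]
      rfl
    · rw [range_add_one', image_insert, map_eq_image, image_image]
      exact congrArg (insert g) hH

/-- Consecutive terms of a pair of sequences form a path. -/
lemma pathOn_segment {v : ℕ → V} {h : ℕ → Finset V} {i j : ℕ} (hij : i ≤ j)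
    (hv : Set.InjOn v (Set.Icc i j)) (hh : Set.InjOn h (Set.Ico i j))
    (hl : ∀ t, i ≤ t → t < j → v t ∈ h t) (hr : ∀ t, i ≤ t → t < j → v (t + 1) ∈ h t) :
    PathOn (v i) (v j) ((Icc i j).image v) ((Ico i j).image h) := by
  induction j, hij using Nat.le_induction with
  | base => simpa using PathOn.nil (v i)
  | succ j hij ih =>
    have p := ih (hv.mono (Set.Icc_subset_Icc_right (by omega)))
      (hh.mono (Set.Ico_subset_Ico_right (by omega))) (fun t h1 h2 => hl t h1 (by omega))
      (fun t h1 h2 => hr t h1 (by omega))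
    rw [← insert_Icc_right_eq_Icc_add_one (by omega), ← insert_Ico_right_eq_Ico_add_one hij,
      image_insert, image_insert]
    refine p.snoc ?_ ?_ (hl j hij (by omega)) (hr j hij (by omega))
    · simp only [mem_image, mem_Icc, not_exists, not_and, and_imp]
      intro t h1 h2 h3
      have := hv (by simp; omega) (by simp; omega) h3
      omega
    · simp only [mem_image, mem_Ico, not_exists, not_and, and_imp]
      intro t h1 h2 h3
      have := hh (by simp; omega) (by simp; omega) h3
      omega

lemma IsPathSeq.segment {n : ℕ} {v : ℕ → V} {h : ℕ → Finset V} (hs : IsPathSeq n v h) {i j : ℕ}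
    (hij : i ≤ j) (hj : j ≤ n) :
    PathOn (v i) (v j) ((Icc i j).image v) ((Ico i j).image h) :=
  pathOn_segment hij (hs.injOn_vertex.mono fun t ht => by simp at ht ⊢; omega)
    (hs.injOn_edge.mono fun t ht => by simp at ht ⊢; omega)
    (fun t _ _ => hs.left_mem t (by omega)) (fun t _ _ => hs.right_mem t (by omega))

lemma hasBergePath_iff {E : Finset (Finset V)} {k : ℕ} :
    HasBergePath E k ↔ ∃ a b U H, PathOn a b U H ∧ H ⊆ E ∧ #H = k := by
  constructor
  · rintro ⟨v, h, hv, hh, hE, hm⟩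
    let v' : ℕ → V := fun i => if hi : i < k + 1 then v ⟨i, hi⟩ else v 0
    let h' : ℕ → Finset V := fun i => if hi : i < k then h ⟨i, hi⟩ else ∅
    have hinj : Set.InjOn h' (range k) := by
      intro i hi j hj hij
      simp only [coe_range, Set.mem_Iio] at hi hj
      simp only [h', hi, hj, dite_true] at hij
      exact congrArg Fin.val (hh hij)
    have hs : IsPathSeq k v' h' := by
      refine ⟨?_, hinj, ?_, ?_⟩
      · intro i hi j hj hij
        simp only [coe_range, Set.mem_Iio] at hi hj
        simp only [v', hi, hj, dite_true] at hij
        exact congrArg Fin.val (hv hij)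
      · intro i hi
        simpa [v', h', hi, hi.le] using (hm ⟨i, hi⟩).1
      · intro i hi
        simpa [v', h', hi] using (hm ⟨i, hi⟩).2
    refine ⟨_, _, _, _, hs.segment (Nat.zero_le k) le_rfl, ?_, ?_⟩
    · intro e he
      simp only [mem_image, mem_Ico] at he
      obtain ⟨i, hi, rfl⟩ := he
      simpa [h', hi.2] using hE ⟨i, hi.2⟩
    · rw [card_image_of_injOn (by simpa using hinj)]
      simp
  · rintro ⟨a, b, U, H, p, hHE, rfl⟩
    obtain ⟨v, h, hs, -, -, -, hH⟩ := p.exists_isPathSeq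
    refine ⟨fun i => v i, fun i => h i, ?_, ?_, ?_, ?_⟩
    · intro i j hij
      exact Fin.ext (hs.injOn_vertex (by simp; omega) (by simp; omega) hij)
    · intro i j hij
      exact Fin.ext (hs.injOn_edge (by simp) (by simp) hij)
    · intro i
      refine hHE ?_
      have : h i ∈ (range #H).image h := mem_image_of_mem _ (by simp)
      rwa [hH] at this
    · intro i
      exact ⟨hs.left_mem i i.2, hs.right_mem i i.2⟩

/-- The `m`-periodic sequences `c` and `g` form a Berge cycle of length `m`. -/
structure IsCycle (m : ℕ) (c : ℕ → V) (g : ℕ → Finset V) : Prop where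
  pos : 0 < m
  periodic_vertex : Function.Periodic c m
  periodic_edge : Function.Periodic g m
  injOn_vertex : Set.InjOn c (range m)
  injOn_edge : Set.InjOn g (range m)
  left_mem : ∀ i, c i ∈ g i
  right_mem : ∀ i, c (i + 1) ∈ g i

lemma injOn_window {α : Type*} {m : ℕ} {c : ℕ → α} (hm : 0 < m) (hp : Function.Periodic c m)
    (hc : Set.InjOn c (range m)) (i : ℕ) : Set.InjOn c (Ico i (i + m)) := by
  intro s hs t ht hst
  rw [← hp.map_mod_nat s, ← hp.map_mod_nat t] at hst
  have h1 := hc (by simpa using Nat.mod_lt s hm) (by simpa using Nat.mod_lt t hm) hst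
  simp only [coe_Ico, Set.mem_Ico] at hs ht
  have h2 : s - i ≡ t - i [MOD m] := by
    refine Nat.ModEq.add_left_cancel' i ?_
    rwa [Nat.add_sub_cancel' hs.1, Nat.add_sub_cancel' ht.1]
  have := Nat.ModEq.eq_of_lt_of_lt h2 (by omega) (by omega)
  omega

lemma image_window {α : Type*} [DecidableEq α] {m : ℕ} {c : ℕ → α} (hm : 0 < m)
    (hp : Function.Periodic c m) (hc : Set.InjOn c (range m)) (i : ℕ) :
    (Ico i (i + m)).image c = (range m).image c := by
  refine eq_of_subset_of_card_le ?_ ?_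
  · intro x hx
    obtain ⟨t, -, rfl⟩ := mem_image.1 hx
    rw [← hp.map_mod_nat t]
    exact mem_image_of_mem _ (by simpa using Nat.mod_lt t hm)
  · rw [card_image_of_injOn hc, card_image_of_injOn (injOn_window hm hp hc i)]
    simp

namespace IsCycle

variable {m : ℕ} {c : ℕ → V} {g : ℕ → Finset V}

lemma injOn_vertex_Ico {α : Type*} {c : ℕ → α} {g : ℕ → Finset α}
    (hc : IsCycle m c g) (i : ℕ) : Set.InjOn c (Ico i (i + m)) :=
  injOn_window hc.pos hc.periodic_vertex hc.injOn_vertex i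

lemma injOn_edge_Ico {α : Type*} {c : ℕ → α} {g : ℕ → Finset α}
    (hc : IsCycle m c g) (i : ℕ) : Set.InjOn g (Ico i (i + m)) :=
  injOn_window hc.pos hc.periodic_edge hc.injOn_edge i

lemma image_vertex_Ico (hc : IsCycle m c g) (i : ℕ) :
    (Ico i (i + m)).image c = (range m).image c :=
  image_window hc.pos hc.periodic_vertex hc.injOn_vertex i

lemma image_edge_Ico (hc : IsCycle m c g) (i : ℕ) :
    (Ico i (i + m)).image g = (range m).image g :=
  image_window hc.pos hc.periodic_edge hc.injOn_edge i

lemma vertex_mem (hc : IsCycle m c g) (i : ℕ) : c i ∈ (range m).image c := by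
  rw [← hc.image_vertex_Ico i]
  exact mem_image_of_mem _ (by simp [hc.pos])

lemma edge_mem (hc : IsCycle m c g) (i : ℕ) : g i ∈ (range m).image g := by
  rw [← hc.image_edge_Ico i]
  exact mem_image_of_mem _ (by simp [hc.pos])

lemma card_vertices (hc : IsCycle m c g) : #((range m).image c) = m := by
  rw [card_image_of_injOn hc.injOn_vertex, card_range]

lemma card_edges (hc : IsCycle m c g) : #((range m).image g) = m := by
  rw [card_image_of_injOn hc.injOn_edge, card_range]

lemma segment (hc : IsCycle m c g) {i j : ℕ} (hij : i ≤ j) (hj : j < i + m) :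
    PathOn (c i) (c j) ((Icc i j).image c) ((Ico i j).image g) :=
  pathOn_segment hij ((hc.injOn_vertex_Ico i).mono fun t ht => by simp at ht ⊢; omega)
    ((hc.injOn_edge_Ico i).mono fun t ht => by simp at ht ⊢; omega)
    (fun t _ _ => hc.left_mem t) (fun t _ _ => hc.right_mem t)

/-- Removing a hyperedge from a cycle leaves a path through all its vertices. -/
lemma pathOn_erase (hc : IsCycle m c g) (i : ℕ) :
    PathOn (c (i + 1)) (c i) ((range m).image c) (((range m).image g).erase (g i)) := by
  have hm := hc.pos
  have p := hc.segment (i := i + 1) (j := i + m) (by omega) (by omega)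
  have h1 : Icc (i + 1) (i + m) = Ico (i + 1) (i + 1 + m) := by ext; simp; omega
  have h2 : Ico i (i + m) = insert i (Ico (i + 1) (i + m)) := by ext; simp; omega
  have h3 : g i ∉ (Ico (i + 1) (i + m)).image g := by
    simp only [mem_image, mem_Ico, not_exists, not_and, and_imp]
    intro t ht1 ht2 ht
    have := hc.injOn_edge_Ico i (by simp; omega) (by simp; omega) ht
    omega
  rwa [h1, hc.image_vertex_Ico, hc.periodic_vertex, ← erase_insert h3, ← image_insert, ← h2,
    hc.image_edge_Ico] at p

end IsCycle

/-- Joining the ends of a path by a new hyperedge yields a cycle. -/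
lemma PathOn.exists_isCycle {a b : V} {U : Finset V} {K : Finset (Finset V)} {e : Finset V}
    (p : PathOn a b U K) (he : e ∉ K) (ha : a ∈ e) (hb : b ∈ e) :
    ∃ c g, IsCycle (#K + 1) c g ∧ (range (#K + 1)).image c = U ∧
      (range (#K + 1)).image g = insert e K := by
  obtain ⟨v, h, hs, h0, hl, hU, hK⟩ := p.exists_isPathSeq
  have hh : ∀ i < #K, h i ∈ K := fun i hi => hK.subset (mem_image_of_mem _ (by simpa using hi))
  have hlt : ∀ i, i % (#K + 1) < #K + 1 := fun i => Nat.mod_lt _ (by omega)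
  let g' : ℕ → Finset V := fun i => if i < #K then h i else e
  have hg : (range (#K + 1)).image g' = insert e K := by
    rw [range_add_one, image_insert]
    congr 1
    · simp [g']
    · refine Eq.trans (image_congr ?_) hK
      intro i hi
      simp only [coe_range, Set.mem_Iio] at hi
      simp [g', hi]
  have hmod : ∀ {α : Type _} (f : ℕ → α), Set.EqOn (fun i => f (i % (#K + 1))) f
      (range (#K + 1)) := by
    intro α f i hi
    simp only [coe_range, Set.mem_Iio] at hi
    simp [Nat.mod_eq_of_lt hi]
  refine ⟨fun i => v (i % (#K + 1)), fun i => g' (i % (#K + 1)),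
    ⟨by omega, fun i => by simp, fun i => by simp, ?_, ?_, ?_, ?_⟩, ?_, ?_⟩
  · exact hs.injOn_vertex.congr (hmod v).symm
  · refine Set.InjOn.congr ?_ (hmod g').symm
    rw [← card_image_iff, hg, card_insert_of_notMem he, card_range]
  · intro i
    by_cases hi : i % (#K + 1) < #K
    · simpa [g', hi] using hs.left_mem _ hi
    · have : i % (#K + 1) = #K := by have := hlt i; omega
      simpa [g', this, hl] using hb
  · intro i
    by_cases hi : i % (#K + 1) < #K
    · have : (i + 1) % (#K + 1) = i % (#K + 1) + 1 := by
        rw [Nat.add_mod_of_add_mod_lt]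
        all_goals rw [Nat.mod_eq_of_lt (a := 1)] <;> omega
      simpa [g', hi, this] using hs.right_mem _ hi
    · have h1 : i % (#K + 1) = #K := by have := hlt i; omega
      have h2 : (i + 1) % (#K + 1) = 0 := by
        rw [Nat.add_mod, h1]
        by_cases h0 : #K = 0
        · simp [h0]
        · rw [Nat.mod_eq_of_lt (a := 1) (by omega)]; simp
      simpa [g', h1, h2, h0] using ha
  · rw [← hU]; exact image_congr (hmod v)
  · rw [← hg]; exact image_congr (hmod g')

/-- `s` is an end of some Berge path whose hyperedges are exactly those in `H`. -/
def IsEnd (H : Finset (Finset V)) (s : V) : Prop :=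
  ∃ b U, PathOn s b U H

lemma exists_mem_notMem_of_card_lt {A B : Finset V} (h : #B < #A) : ∃ x ∈ A, x ∉ B := by
  by_contra! hc
  exact absurd (card_le_card hc) (by omega)

/-- If a Berge path cannot be lengthened, all hyperedges meeting its possible ends belong to it. -/
lemma edge_mem_of_isEnd {E H : Finset (Finset V)} {r : ℕ} {e : Finset V} {s : V}
    (hE : ∀ e ∈ E, #e = r) (hH : H ⊆ E) (hr : #H < r) (hpos : H.Nonempty)
    (hno : ¬ HasBergePath E (#H + 1)) (he : e ∈ E) (hse : s ∈ e) (hs : IsEnd H s) : e ∈ H := by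
  by_contra heH
  obtain ⟨b, U, p⟩ := hs
  have hU := p.card_eq
  have hsub : e ⊆ U := by
    intro w hw
    by_contra hwU
    exact hno (hasBergePath_iff.2 ⟨_, _, _, _, p.cons hwU heH hw hse,
      insert_subset he hH, card_insert_of_notMem heH⟩)
  have heU : e = U := eq_of_subset_of_card_le hsub (by rw [hE e he]; omega)
  obtain ⟨c, g, hc, hcU, hgK⟩ := p.exists_isCycle heH hse (heU ▸ p.right_mem)
  obtain ⟨h, hh⟩ := hpos
  have hne : ¬ h ⊆ U := fun hsub => heH (by
    rw [heU, ← eq_of_subset_of_card_le hsub (by rw [hE h (hH hh)]; omega)]; exact hh)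
  obtain ⟨w, hwh, hwU⟩ := not_subset.1 hne
  have : h ∈ (range (#H + 1)).image g := by rw [hgK]; exact mem_insert_of_mem hh
  obtain ⟨i, -, rfl⟩ := mem_image.1 this
  have q := hc.pathOn_erase i
  rw [hcU, hgK] at q
  have q' := q.cons hwU (by simp) hwh (hc.right_mem i)
  rw [insert_erase (mem_insert_of_mem hh)] at q'
  exact hno (hasBergePath_iff.2 ⟨_, _, _, _, q', insert_subset he hH,
    card_insert_of_notMem heH⟩)

/-- If the hyperedges of `insert e K` form a Berge cycle, each vertex they cover is an end of a
path using all of them. -/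
lemma PathOn.exists_ends_of_cycle {a b : V} {U : Finset V} {K : Finset (Finset V)} {e : Finset V}
    {r : ℕ} (p : PathOn a b U K) (he : e ∉ K) (ha : a ∈ e) (hb : b ∈ e) (hK : 1 ≤ #K)
    (hr : #K + 2 ≤ r) (hu : ∀ h ∈ insert e K, #h = r) :
    ∃ S : Finset V, r + 1 ≤ #S ∧ ∀ s ∈ S, IsEnd (insert e K) s := by
  obtain ⟨c, g, hc, hcU, hgK⟩ := p.exists_isCycle he ha hb
  have hU := p.card_eq
  have key : ∀ h ∈ insert e K, ∀ x ∈ h, IsEnd (insert e K) x := by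
    intro h hh x hx
    by_cases hxU : x ∈ U
    · have hxi : x ∈ (Ico 1 (1 + (#K + 1))).image c := by rwa [hc.image_vertex_Ico, hcU]
      obtain ⟨t, ht, rfl⟩ := mem_image.1 hxi
      obtain ⟨i, rfl⟩ : ∃ i, t = i + 1 := ⟨t - 1, by simp at ht; omega⟩
      have q := hc.pathOn_erase i
      have hi := hc.edge_mem i
      rw [hcU] at q
      obtain ⟨w, hw, hwU⟩ := exists_mem_notMem_of_card_lt (A := g i) (B := U)
        (by rw [hu (g i) (by rw [← hgK]; exact hi)]; omega)
      have q' := q.snoc hwU (by simp) (hc.left_mem i) hw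
      rw [insert_erase hi, hgK] at q'
      exact ⟨_, _, q'⟩
    · rw [← hgK] at hh
      obtain ⟨i, -, rfl⟩ := mem_image.1 hh
      have q := hc.pathOn_erase i
      rw [hcU] at q
      have q' := q.cons hxU (by simp) hx (hc.right_mem i)
      rw [insert_erase hh, hgK] at q'
      exact ⟨_, _, q'⟩
  obtain ⟨h, hh⟩ := card_pos.1 hK
  refine ⟨e ∪ h, ?_, ?_⟩
  · have hne : ¬ h ⊆ e := fun hsub => he (by
      rw [← eq_of_subset_of_card_le hsub (by rw [hu e (by simp), hu h (by simp [hh])])]; exact hh)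
    obtain ⟨w, hw, hwe⟩ := not_subset.1 hne
    have : insert w e ⊆ e ∪ h := insert_subset (by simp [hw]) subset_union_left
    have := card_le_card this
    rwa [card_insert_of_notMem hwe, hu e (by simp)] at this
  · intro s hs
    rcases mem_union.1 hs with h1 | h1
    · exact key e (by simp) s h1
    · exact key h (by simp [hh]) s h1

lemma card_add_one_le_card_biUnion_add {I : Finset ℕ} {B : ℕ → Finset V} (hI : I.Nonempty)
    (hB : ∀ i ∈ I, 2 ≤ #(B i)) :
    #I + 1 ≤ #(I.biUnion B) + #{j ∈ I | ∃ i ∈ I, i ≠ j ∧ ¬ Disjoint (B i) (B j)} := by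
  have hsplit := card_filter_add_card_filter_not (s := I)
    (fun j => ∃ i ∈ I, i ≠ j ∧ ¬ Disjoint (B i) (B j))
  set I₀ := {j ∈ I | ¬ ∃ i ∈ I, i ≠ j ∧ ¬ Disjoint (B i) (B j)} 
  have hpos : 2 ≤ #(I.biUnion B) := by
    obtain ⟨i, hi⟩ := hI
    exact (hB i hi).trans (card_le_card (subset_biUnion_of_mem B hi))
  have hle : 2 * #I₀ ≤ #(I.biUnion B) := by
    have hdis : #(I₀.biUnion B) = ∑ i ∈ I₀, #(B i) := by
      refine card_biUnion fun i hi j hj hij => ?_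
      by_contra hd
      exact (mem_filter.1 hj).2 ⟨i, (mem_filter.1 hi).1, hij, hd⟩
    have hsum : #I₀ * 2 ≤ ∑ i ∈ I₀, #(B i) := by
      rw [← smul_eq_mul]
      exact card_nsmul_le_sum _ _ _ fun i hi => hB i (mem_filter.1 hi).1
    have : #(I₀.biUnion B) ≤ #(I.biUnion B) :=
      card_le_card (biUnion_subset_biUnion_of_subset_left B (filter_subset _ _))
    omega
  omega

namespace IsCycle

variable {m : ℕ} {c : ℕ → V} {g : ℕ → Finset V} {f : Finset V} {w x : V}

/-- A hyperedge `f` outside a cycle meeting it in `c (i + 1)` gives a path through the whole cycle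
that starts with `f` and ends with `g i`. -/
lemma pathOn_of_pendant (hc : IsCycle m c g) (hf : f ∉ (range m).image g) {i : ℕ}
    (hi : c (i + 1) ∈ f) (hw : w ∈ f) (hwC : w ∉ (range m).image c) (hx : x ∈ g i)
    (hxC : x ∉ (range m).image c) (hwx : w ≠ x) :
    PathOn w x (insert x (insert w ((range m).image c))) (insert f ((range m).image g)) := by
  have hgf : g i ≠ f := fun h => hf (h ▸ hc.edge_mem i)
  have q := (hc.pathOn_erase i).cons hwC (fun h => hf (mem_of_mem_erase h)) hw hi
  have q' := q.snoc (x := x) (h := g i) (by simp [hxC, hwx.symm])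
    (by simp [hgf]) (hc.left_mem i) hx
  rwa [insert_comm (g i), insert_erase (hc.edge_mem i)] at q'

/-- If two hyperedges of a cycle share a vertex outside it, rotating the path of
`pathOn_of_pendant` produces an end on the cycle. -/
lemma isEnd_of_shared (hc : IsCycle m c g) (hf : f ∉ (range m).image g) {i j : ℕ}
    (hij : i < j) (hj : j < i + m) (hi : c (i + 1) ∈ f) (hw : w ∈ f)
    (hwC : w ∉ (range m).image c) (hxi : x ∈ g i) (hxj : x ∈ g j)
    (hxC : x ∉ (range m).image c) (hwx : w ≠ x) :
    IsEnd (insert f ((range m).image g)) (c (j + 1)) := by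
  have hCne : ∀ t, c t ∈ (range m).image c := hc.vertex_mem
  have hfne : ∀ t, g t ≠ f := fun t h => hf (h ▸ hc.edge_mem t)
  have hcx : ∀ t, c t ≠ x := fun t h => hxC (h ▸ hCne t)
  have hcw : ∀ t, c t ≠ w := fun t h => hwC (h ▸ hCne t)
  have hginj : ∀ s t, i ≤ s → s < i + m → i ≤ t → t < i + m → g s = g t → s = t :=
    fun s t h1 h2 h3 h4 h => hc.injOn_edge_Ico i (by simp; omega) (by simp; omega) h
  have p := hc.segment (i := i + 1) (j := j) (by omega) (by omega)
  have p1 := p.cons (a := w) (h := f) (by simp [hcw]) (by simp [hfne]) hw hi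
  have p2 := p1.snoc (x := x) (h := g j) (by simp [hcx, hwx.symm])
    (by
      simp only [mem_insert, mem_image, mem_Ico, not_or, not_exists, not_and, and_imp]
      refine ⟨hfne j, fun t h1 h2 h3 => ?_⟩
      have := hginj t j (by omega) (by omega) (by omega) (by omega) h3
      omega) (hc.left_mem j) hxj
  have q := hc.segment (i := j + 1) (j := i + m) (by omega) (by omega)
  have q' := q.join (h := g i) p2.reverse
    (by
      rw [disjoint_left]
      intro y hy
      obtain ⟨s, hs, rfl⟩ := mem_image.1 hy
      simp only [mem_insert, mem_image, mem_Icc, not_or, not_exists, not_and, and_imp] at hs ⊢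
      refine ⟨hcx s, hcw s, fun t h1 h2 h3 => ?_⟩
      have := hc.injOn_vertex_Ico (i + 1) (by simp; omega) (by simp; omega) h3
      omega)
    (by
      rw [disjoint_left]
      intro y hy
      obtain ⟨s, hs, rfl⟩ := mem_image.1 hy
      simp only [mem_insert, mem_image, mem_Ico, not_or, not_exists, not_and, and_imp] at hs ⊢
      refine ⟨fun h => ?_, hfne s, fun t h1 h2 h3 => ?_⟩
      · have := hginj s j (by omega) (by omega) (by omega) (by omega) h
        omega
      · have := hginj t s (by omega) (by omega) (by omega) (by omega) h3
        omega)
    (by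
      simp only [mem_image, mem_Ico, not_exists, not_and, and_imp]
      intro t h1 h2 h3
      have := hginj t i (by omega) (by omega) (by omega) (by omega) h3
      omega)
    (by
      simp only [mem_insert, mem_image, mem_Ico, not_or, not_exists, not_and, and_imp]
      refine ⟨fun h => ?_, hfne i, fun t h1 h2 h3 => ?_⟩
      · have := hginj i j (by omega) (by omega) (by omega) (by omega) h
        omega
      · have := hginj t i (by omega) (by omega) (by omega) (by omega) h3
        omega)
    (by rw [hc.periodic_vertex]; exact hc.left_mem i) hxi
  have hset : Ico i (i + m) = insert i (Ico (j + 1) (i + m) ∪ insert j (Ico (i + 1) j)) := by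
    ext; simp; omega
  have hset' : insert f ((range m).image g) = insert (g i) ((Ico (j + 1) (i + m)).image g ∪
      insert (g j) (insert f ((Ico (i + 1) j).image g))) := by
    rw [← hc.image_edge_Ico i, hset, image_insert, image_union, image_insert]
    ext y
    simp only [mem_insert, mem_union]
    tauto
  exact ⟨_, _, hset' ▸ q'⟩

end IsCycle

/-- If the hyperedges of `insert e K` form a Berge cycle and one further hyperedge `f` meets the
cycle, then at least `r + 1` vertices are ends of paths using all these hyperedges. -/
lemma PathOn.exists_ends_of_lasso {a b u : V} {U : Finset V} {K : Finset (Finset V)}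
    {e f : Finset V} {r : ℕ} (p : PathOn a b U K) (he : e ∉ K) (ha : a ∈ e) (hb : b ∈ e)
    (hf : f ∉ insert e K) (huU : u ∈ U) (huf : u ∈ f) (hr : #K + 3 ≤ r)
    (hu : ∀ h ∈ insert f (insert e K), #h = r) :
    ∃ S : Finset V, r + 1 ≤ #S ∧ ∀ s ∈ S, IsEnd (insert f (insert e K)) s := by
  obtain ⟨c, g, hc, hcU, hgK⟩ := p.exists_isCycle he ha hb
  rw [← hcU] at huU
  rw [← hgK] at hf hu ⊢
  set m := #K + 1 with hm
  set C := (range m).image c with hC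
  have hCm : #C = m := hc.card_vertices
  by_cases hA : ∃ i x, c (i + 1) ∈ f ∧ x ∈ f ∧ x ∈ g i ∧ x ∉ C
  · obtain ⟨i, x, hi, hxf, hxg, hxC⟩ := hA
    have hgf : g i ≠ f := fun h => hf (h ▸ hc.edge_mem i)
    have hfe : f ∉ ((range m).image g).erase (g i) := fun h => hf (mem_of_mem_erase h)
    have q := (hc.pathOn_erase i).cons hxC hfe hxf hi
    have hset : insert (g i) (insert f (((range m).image g).erase (g i))) =
        insert f ((range m).image g) := by
      rw [insert_comm, insert_erase (hc.edge_mem i)]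
    have hcard : #(insert f (((range m).image g).erase (g i))) = m := by
      rw [card_insert_of_notMem hfe, card_erase_of_mem (hc.edge_mem i), hc.card_edges]
      omega
    have := q.exists_ends_of_cycle (e := g i) (r := r) (by simp [hgf]) hxg (hc.left_mem i)
      (by omega) (by omega) (by rwa [hset])
    rwa [hset] at this
  push Not at hA
  have hCr : ∀ h ∈ insert f ((range m).image g), 2 ≤ #(h \ C) := by
    intro h hh
    have := le_card_sdiff C h
    have := hu h hh
    omega
  have hfC := hCr f (by simp)
  have hgC : ∀ i, 2 ≤ #(g i \ C) := fun i => hCr _ (mem_insert_of_mem (hc.edge_mem i))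
  let I : Finset ℕ := {i ∈ range m | c (i + 1) ∈ f}
  let B : ℕ → Finset V := fun i => g i \ C
  let I₁ : Finset ℕ := {j ∈ I | ∃ i ∈ I, i ≠ j ∧ ¬ Disjoint (B i) (B j)}
  have hinj : Set.InjOn (fun i => c (i + 1)) (range m) := by
    intro s hs t ht hst
    simp only [coe_range, Set.mem_Iio] at hs ht
    have := hc.injOn_vertex_Ico 1 (by simp; omega) (by simp; omega) hst
    omega
  have hfI : f ∩ C = I.image fun i => c (i + 1) := by
    ext y
    simp only [mem_inter, mem_image, I, mem_filter]
    constructor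
    · rintro ⟨hyf, hyC⟩
      rw [hC, ← hc.image_vertex_Ico 1, mem_image] at hyC
      obtain ⟨t, ht, rfl⟩ := hyC
      simp only [mem_Ico] at ht
      have : t - 1 + 1 = t := by omega
      exact ⟨t - 1, ⟨by simp; omega, by rwa [this]⟩, by rw [this]⟩
    · rintro ⟨i, ⟨-, hi⟩, rfl⟩
      exact ⟨hi, hc.vertex_mem _⟩
  have hIcard : #(f ∩ C) = #I := by
    rw [hfI]
    exact card_image_of_injOn (hinj.mono fun i hi => (mem_filter.1 hi).1)
  have hIne : I.Nonempty := by
    rw [← card_pos, ← hIcard, card_pos]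
    exact ⟨u, mem_inter.2 ⟨huf, huU⟩⟩
  have hcount := card_add_one_le_card_biUnion_add (B := B) hIne fun i _ => hgC i
  refine ⟨(f \ C) ∪ (I.biUnion B ∪ I₁.image fun i => c (i + 1)), ?_, ?_⟩
  · have d1 : Disjoint (I.biUnion B) (I₁.image fun i => c (i + 1)) := by
      rw [disjoint_left]
      intro y hy hy'
      obtain ⟨i, -, hi⟩ := mem_biUnion.1 hy
      obtain ⟨j, -, rfl⟩ := mem_image.1 hy'
      exact (mem_sdiff.1 hi).2 (hc.vertex_mem _)
    have d2 : Disjoint (f \ C) (I.biUnion B ∪ I₁.image fun i => c (i + 1)) := by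
      rw [disjoint_left]
      intro y hy hy'
      obtain ⟨hyf, hyC⟩ := mem_sdiff.1 hy
      rcases mem_union.1 hy' with h | h
      · obtain ⟨i, hi, hi'⟩ := mem_biUnion.1 h
        exact hyC (hA i y (mem_filter.1 hi).2 hyf (mem_sdiff.1 hi').1)
      · obtain ⟨j, -, rfl⟩ := mem_image.1 h
        exact hyC (hc.vertex_mem _)
    have hI₁ : #(I₁.image fun i => c (i + 1)) = #I₁ :=
      card_image_of_injOn (hinj.mono fun i hi => (mem_filter.1 (mem_filter.1 hi).1).1)
    rw [card_union_of_disjoint d2, card_union_of_disjoint d1, hI₁]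
    have h1 := card_sdiff_add_card_inter f C
    have h2 := hu f (by simp)
    have h3 : #I + 1 ≤ #(I.biUnion B) + #I₁ := hcount
    omega
  · have hne : ∀ i ∈ I, ∀ w ∈ f, ∀ x ∈ g i, x ∉ C → w ≠ x := by
      rintro i hi w hw x hx hxC rfl
      exact hxC (hA i w (mem_filter.1 hi).2 hw hx)
    have hpend : ∀ i ∈ I, ∀ w ∈ f \ C, ∀ x ∈ B i, IsEnd (insert f ((range m).image g)) w ∧
        IsEnd (insert f ((range m).image g)) x := by
      intro i hi w hw x hx
      obtain ⟨hwf, hwC⟩ := mem_sdiff.1 hw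
      obtain ⟨hxg, hxC⟩ := mem_sdiff.1 hx
      have q := hc.pathOn_of_pendant hf (mem_filter.1 hi).2 hwf hwC hxg hxC
        (hne i hi w hwf x hxg hxC)
      exact ⟨⟨_, _, q⟩, ⟨_, _, q.reverse⟩⟩
    obtain ⟨w, hw⟩ := card_pos.1 (two_pos.trans_le hfC)
    obtain ⟨hwf, hwC⟩ := mem_sdiff.1 hw
    intro s hs
    simp only [mem_union] at hs
    rcases hs with hs | hs | hs
    · obtain ⟨i, hi⟩ := hIne
      obtain ⟨x, hx⟩ := card_pos.1 (two_pos.trans_le (hgC i))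
      exact (hpend i hi s hs x hx).1
    · obtain ⟨i, hi, hi'⟩ := mem_biUnion.1 hs
      exact (hpend i hi w hw s hi').2
    · obtain ⟨j, hj, rfl⟩ := mem_image.1 hs
      obtain ⟨hjI, i, hiI, hij, hd⟩ := mem_filter.1 hj
      obtain ⟨x, hxi, hxj⟩ := not_disjoint_iff.1 hd
      obtain ⟨hxi, hxC⟩ := mem_sdiff.1 hxi
      obtain ⟨hxj, -⟩ := mem_sdiff.1 hxj
      have hwx := hne i hiI w hwf x hxi hxC
      obtain ⟨him, hif⟩ := mem_filter.1 hiI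
      have hjm := (mem_filter.1 hjI).1
      simp only [mem_range] at him hjm
      rcases lt_or_gt_of_ne hij with hlt | hlt
      · exact hc.isEnd_of_shared hf hlt (by omega) hif hwf hwC hxi hxj hxC hwx
      · have := hc.isEnd_of_shared hf (j := j + m) (by omega) (by omega) hif hwf hwC hxi
          (by rwa [hc.periodic_edge]) hxC hwx
        rwa [add_right_comm, hc.periodic_vertex] at this

namespace IsPathSeq

variable {n : ℕ} {v : ℕ → V} {h : ℕ → Finset V}

lemma edge_notMem_image (hs : IsPathSeq n v h) {i : ℕ} {A : Finset ℕ} (hi : i < n)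
    (hA : ∀ t ∈ A, t < n ∧ t ≠ i) : h i ∉ A.image h := by
  intro hmem
  obtain ⟨t, ht, hti⟩ := mem_image.1 hmem
  exact (hA t ht).2 (hs.injOn_edge (by simpa using (hA t ht).1) (by simpa using hi) hti)

lemma disjoint_image_edge (hs : IsPathSeq n v h) {A B : Finset ℕ} (hA : ∀ t ∈ A, t < n)
    (hB : ∀ t ∈ B, t < n) (hAB : Disjoint A B) : Disjoint (A.image h) (B.image h) := by
  rw [disjoint_left]
  intro y hy hy'
  obtain ⟨s, hs', rfl⟩ := mem_image.1 hy
  obtain ⟨t, ht, hst⟩ := mem_image.1 hy'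
  have := hs.injOn_edge (by simpa using hB t ht) (by simpa using hA s hs') hst
  exact disjoint_left.1 hAB hs' (this ▸ ht)

lemma disjoint_image_vertex (hs : IsPathSeq n v h) {A B : Finset ℕ} (hA : ∀ t ∈ A, t ≤ n)
    (hB : ∀ t ∈ B, t ≤ n) (hAB : Disjoint A B) : Disjoint (A.image v) (B.image v) := by
  rw [disjoint_left]
  intro y hy hy'
  obtain ⟨s, hs', rfl⟩ := mem_image.1 hy
  obtain ⟨t, ht, hst⟩ := mem_image.1 hy'
  have := hs.injOn_vertex (by simpa [Nat.lt_succ_iff] using hB t ht)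
    (by simpa [Nat.lt_succ_iff] using hA s hs') hst
  exact disjoint_left.1 hAB hs' (this ▸ ht)

lemma card_image_edge (hs : IsPathSeq n v h) {A : Finset ℕ} (hA : ∀ t ∈ A, t < n) :
    #(A.image h) = #A :=
  card_image_of_injOn (hs.injOn_edge.mono fun t ht => by simpa using hA t ht)

/-- The hyperedges of a path with at least two hyperedges have at least `r + 1` ends. -/
lemma exists_ends (hs : IsPathSeq (n + 2) v h) {r : ℕ} (hr : n + 3 ≤ r)
    (hu : ∀ e ∈ (range (n + 2)).image h, #e = r) :
    ∃ S : Finset V, r + 1 ≤ #S ∧ ∀ s ∈ S, IsEnd ((range (n + 2)).image h) s := by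
  have hleft : range (n + 2) = insert 0 (Ico 1 (n + 2)) := by ext; simp; omega
  have hright : range (n + 2) = insert (n + 1) (Ico 0 (n + 1)) := by ext; simp; omega
  have n0 : h 0 ∉ (Ico 1 (n + 2)).image h :=
    hs.edge_notMem_image (by omega) fun t ht => by simp at ht; omega
  have n1 : h (n + 1) ∉ (Ico 0 (n + 1)).image h :=
    hs.edge_notMem_image (by omega) fun t ht => by simp at ht; omega
  have p0 := hs.segment (i := 1) (j := n + 2) (by omega) le_rfl
  have p1 := hs.segment (i := 0) (j := n + 1) (by omega) (by omega)
  have hl0 := hs.left_mem 0 (by omega)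
  have hr0 := hs.right_mem 0 (by omega)
  have hl1 := hs.left_mem (n + 1) (by omega)
  have hr1 := hs.right_mem (n + 1) (by omega)
  by_cases c0 : v (n + 2) ∈ h 0
  · have := p0.exists_ends_of_cycle (r := r) n0 hr0 c0
      (by rw [hs.card_image_edge] <;> simp)
      (by rw [hs.card_image_edge] <;> simp; omega)
      (by rwa [← image_insert, ← hleft])
    rwa [← image_insert, ← hleft] at this
  by_cases c1 : v 0 ∈ h (n + 1)
  · have := p1.exists_ends_of_cycle (r := r) n1 c1 hl1
      (by rw [hs.card_image_edge]; · simp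
          intro t ht; simp at ht; omega)
      (by rw [hs.card_image_edge]; · simp; omega
          intro t ht; simp at ht; omega)
      (by rwa [← image_insert, ← hright])
    rwa [← image_insert, ← hright] at this
  let A₀ := h 0 \ (Icc 1 (n + 2)).image v
  let A₁ := h (n + 1) \ (Icc 0 (n + 1)).image v
  by_cases hA : Disjoint A₀ A₁
  swap
  · obtain ⟨x, hx0, hx1⟩ := not_disjoint_iff.1 hA
    obtain ⟨hxh0, hxU0⟩ := mem_sdiff.1 hx0
    obtain ⟨hxh1, hxU1⟩ := mem_sdiff.1 hx1
    have p := hs.segment (i := 1) (j := n + 1) (by omega) (by omega)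
    have hset : range (n + 2) = insert (n + 1) (insert 0 (Ico 1 (n + 1))) := by ext; simp; omega
    have q := p.cons (a := x) (h := h 0)
      (fun hx => hxU1 (image_subset_image (Icc_subset_Icc_left (by omega)) hx))
      (fun hh => n0 (image_subset_image (Ico_subset_Ico_right (by omega)) hh)) hxh0 hr0
    rw [← image_insert] at q
    have hcard : #((insert 0 (Ico 1 (n + 1))).image h) = n + 1 := by
      rw [hs.card_image_edge, card_insert_of_notMem] <;> simp
      intro t ht1 ht2; omega
    have := q.exists_ends_of_cycle (r := r) (e := h (n + 1))
      (hs.edge_notMem_image (by omega) fun t ht => by simp at ht; omega)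
      hxh1 hl1 (by omega) (by omega) (by rwa [← image_insert, ← hset])
    rwa [← image_insert, ← hset] at this
  by_cases hcross : ∃ i, 0 < i ∧ i < n + 1 ∧ v (i + 1) ∈ h 0 ∧ v i ∈ h (n + 1)
  · obtain ⟨i, hi0, hin, hi1, hi2⟩ := hcross
    have q0 := hs.segment (i := 1) (j := i) (by omega) (by omega)
    have q1 := hs.segment (i := i + 1) (j := n + 1) (by omega) (by omega)
    have q := q0.join (h := h (n + 1)) q1.reverse
      (hs.disjoint_image_vertex (fun t ht => by simp at ht; omega)
        (fun t ht => by simp at ht; omega)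
        (disjoint_left.2 fun t h1 h2 => by simp at h1 h2; omega))
      (hs.disjoint_image_edge (fun t ht => by simp at ht; omega)
        (fun t ht => by simp at ht; omega)
        (disjoint_left.2 fun t h1 h2 => by simp at h1 h2; omega))
      (hs.edge_notMem_image (by omega) fun t ht => by simp at ht; omega)
      (hs.edge_notMem_image (by omega) fun t ht => by simp at ht; omega) hi2 hl1
    rw [← image_union, ← image_union, ← image_insert] at q
    have hset : range (n + 2) =
        insert i (insert 0 (insert (n + 1) (Ico 1 i ∪ Ico (i + 1) (n + 1)))) := by
      ext; simp; omega
    have hcard : #((insert (n + 1) (Ico 1 i ∪ Ico (i + 1) (n + 1))).image h) ≤ n := by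
      refine card_image_le.trans ?_
      refine (card_insert_le _ _).trans ?_
      refine (Nat.add_le_add_right (card_union_le _ _) 1).trans ?_
      simp; omega
    have := q.exists_ends_of_lasso (r := r) (e := h 0) (f := h i) (u := v i)
      (hs.edge_notMem_image (by omega) fun t ht => by simp at ht; omega) hr0 hi1
      (by rw [← image_insert]
          exact hs.edge_notMem_image (by omega) fun t ht => by simp at ht; omega)
      (mem_image_of_mem _ (by simp; omega)) (hs.left_mem i (by omega)) (by omega)
      (by rwa [← image_insert, ← image_insert, ← hset])
    rwa [← image_insert, ← image_insert, ← hset] at this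
  let X : Finset ℕ := {i ∈ range (n + 2) | v (i + 1) ∈ h 0}
  let Y : Finset ℕ := {i ∈ range (n + 2) | v i ∈ h (n + 1)}
  have hXY : #X + #Y ≤ n + 2 := by
    rw [← card_union_of_disjoint]
    · refine (card_le_card (union_subset (filter_subset _ _) (filter_subset _ _))).trans ?_
      simp
    · rw [disjoint_left]
      intro i hiX hiY
      obtain ⟨hi, hiX⟩ := mem_filter.1 hiX
      obtain ⟨-, hiY⟩ := mem_filter.1 hiY
      simp only [mem_range] at hi
      refine hcross ⟨i, ?_, ?_, hiX, hiY⟩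
      · rcases Nat.eq_zero_or_pos i with rfl | h0
        · exact absurd hiY c1
        · exact h0
      · by_contra hlt
        obtain rfl : i = n + 1 := by omega
        exact c0 hiX
  have hX : h 0 ∩ (Icc 1 (n + 2)).image v ⊆ X.image fun i => v (i + 1) := by
    intro y hy
    obtain ⟨hy0, hy⟩ := mem_inter.1 hy
    obtain ⟨t, ht, rfl⟩ := mem_image.1 hy
    obtain ⟨i, rfl⟩ : ∃ i, t = i + 1 := ⟨t - 1, by simp at ht; omega⟩
    exact mem_image.2 ⟨i, mem_filter.2 ⟨by simp at ht ⊢; omega, hy0⟩, rfl⟩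
  have hY : h (n + 1) ∩ (Icc 0 (n + 1)).image v ⊆ Y.image v := by
    intro y hy
    obtain ⟨hy0, hy⟩ := mem_inter.1 hy
    obtain ⟨t, ht, rfl⟩ := mem_image.1 hy
    exact mem_image.2 ⟨t, mem_filter.2 ⟨by simp at ht ⊢; omega, hy0⟩, rfl⟩
  refine ⟨A₀ ∪ A₁, ?_, ?_⟩
  · rw [card_union_of_disjoint hA]
    have h1 := (card_le_card hX).trans card_image_le
    have h2 := (card_le_card hY).trans card_image_le
    have h3 : #A₀ + _ = _ := card_sdiff_add_card_inter (h 0) ((Icc 1 (n + 2)).image v)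
    have h4 : #A₁ + _ = _ := card_sdiff_add_card_inter (h (n + 1)) ((Icc 0 (n + 1)).image v)
    rw [hu _ (mem_image_of_mem _ (by simp))] at h3 h4
    omega
  · intro s hs'
    rcases mem_union.1 hs' with hs' | hs'
    · obtain ⟨h1, h2⟩ := mem_sdiff.1 hs'
      have := p0.cons h2 n0 h1 hr0
      rw [← image_insert, ← hleft] at this
      exact ⟨_, _, this⟩
    · obtain ⟨h1, h2⟩ := mem_sdiff.1 hs'
      have := (p1.snoc h2 n1 hl1 h1).reverse
      rw [← image_insert, ← hright] at this
      exact ⟨_, _, this⟩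

end IsPathSeq

/-- Some nonempty set of vertices meets few hyperedges. -/
lemma exists_sparse_set {E : Finset (Finset V)} {r k : ℕ} (hk : k ≤ r) (h2 : 2 < k)
    (hE : ∀ e ∈ E, #e = r) (hno : ¬ HasBergePath E k) (hne : E.Nonempty) :
    ∃ S ⊆ E.biUnion id, S.Nonempty ∧
      #{e ∈ E | ¬ Disjoint e S} * (r + 1) ≤ #S * (k - 1) := by
  obtain ⟨e₀, he₀⟩ := hne
  have hone : HasBergePath E 1 := by
    obtain ⟨x, hx, y, hy, hxy⟩ := one_lt_card.1 (by rw [hE e₀ he₀]; omega : 1 < #e₀)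
    refine hasBergePath_iff.2 ⟨x, y, _, _, (PathOn.nil y).cons (h := e₀) ?_ ?_ hx hy, ?_, ?_⟩
    · simpa using hxy
    · simp
    · simpa using he₀
    · simp
  obtain ⟨l, hl1, hlk, hl, hl'⟩ : ∃ l, 1 ≤ l ∧ l < k ∧ HasBergePath E l ∧
      ¬ HasBergePath E (l + 1) := by
    by_contra! hc
    have : ∀ l, 1 ≤ l → l ≤ k → HasBergePath E l := by
      intro l hl
      induction l, hl using Nat.le_induction with
      | base => exact fun _ => hone
      | succ l hl ih => exact fun hlk => hc l hl hlk (ih (by omega))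
    exact hno (this k (by omega) le_rfl)
  obtain ⟨a, b, U, H, p, hHE, hHl⟩ := hasBergePath_iff.1 hl
  obtain ⟨v, h, hs, -, -, -, hH⟩ := p.exists_isPathSeq
  obtain ⟨S, hS, hSend⟩ : ∃ S : Finset V, l * (r + 1) ≤ #S * (k - 1) ∧ ∀ s ∈ S, IsEnd H s := by
    rw [hHl] at hs hH
    rcases Nat.lt_or_ge 1 l with hl2 | hl2
    · obtain ⟨n, rfl⟩ : ∃ n, l = n + 2 := ⟨l - 2, by omega⟩
      obtain ⟨S, hS, hS'⟩ := hs.exists_ends (r := r) (by omega) (by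
        rw [hH]; exact fun e he => hE e (hHE he))
      rw [hH] at hS'
      refine ⟨S, ?_, hS'⟩
      rw [mul_comm]
      exact Nat.mul_le_mul hS (by omega)
    · obtain rfl : l = 1 := by omega
      have hHe : H = {h 0} := by rw [← hH]; simp
      refine ⟨h 0, ?_, ?_⟩
      · rw [hE (h 0) (hHE (by rw [hHe]; simp))]
        have : r * 2 ≤ r * (k - 1) := Nat.mul_le_mul_left r (by omega)
        omega
      · intro s hs0
        obtain ⟨y, hy, hys⟩ : ∃ y ∈ h 0, y ≠ s :=
          exists_mem_ne (by rw [hE (h 0) (hHE (by rw [hHe]; simp))]; omega) s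
        have := (PathOn.nil y).cons (a := s) (h := h 0) (by simpa using hys.symm) (by simp) hs0 hy
        exact ⟨_, _, by simpa [hHe] using this⟩
  have hpos : H.Nonempty := card_pos.1 (by omega)
  refine ⟨S, ?_, ?_, ?_⟩
  · intro s hs
    obtain ⟨b, U, q⟩ := hSend s hs
    cases q with
    | nil => simp at hpos
    | cons ha hh hah hbh q => exact mem_biUnion.2 ⟨_, hHE (mem_insert_self _ _), hah⟩
  · rw [← card_pos]
    by_contra h0
    have : #S = 0 := by omega
    rw [this, zero_mul] at hS
    exact absurd hS (not_le.2 (Nat.mul_pos hl1 (Nat.succ_pos r)))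
  · refine le_trans (Nat.mul_le_mul_right _ ?_) hS
    rw [← hHl]
    refine card_le_card fun e he => ?_
    obtain ⟨he, hd⟩ := mem_filter.1 he
    obtain ⟨s, hse, hsS⟩ := not_disjoint_iff.1 hd
    exact edge_mem_of_isEnd hE hHE (by omega) hpos (by rwa [hHl]) he hse (hSend s hsS)

lemma card_mul_le {r k : ℕ} (hk : k ≤ r) (h2 : 2 < k) (W : Finset V) (E : Finset (Finset V))
    (hEW : ∀ e ∈ E, e ⊆ W) (hE : ∀ e ∈ E, #e = r) (hno : ¬ HasBergePath E k) :
    #E * (r + 1) ≤ #W * (k - 1) := by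
  induction W using Finset.strongInduction generalizing E with
  | H W ih =>
    rcases E.eq_empty_or_nonempty with rfl | hne
    · simp
    obtain ⟨S, hSE, hS, hcard⟩ := exists_sparse_set hk h2 hE hno hne
    have hSW : S ⊆ W := hSE.trans (biUnion_subset.2 hEW)
    have := ih (W \ S) (sdiff_ssubset hSW hS) {e ∈ E | Disjoint e S}
      (fun e he => subset_sdiff.2 ⟨hEW e (mem_filter.1 he).1, (mem_filter.1 he).2⟩)
      (fun e he => hE e (mem_filter.1 he).1)
      (fun hb => hno (by
        obtain ⟨v, h, hv, hh, hm, hi⟩ := hb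
        exact ⟨v, h, hv, hh, fun i => (mem_filter.1 (hm i)).1, hi⟩))
    rw [← card_filter_add_card_filter_not (s := E) (fun e => Disjoint e S),
      ← card_sdiff_add_card_eq_card hSW, add_mul, add_mul]
    exact add_le_add this hcard

lemma exists_extremal {r k q : ℕ} (hk : k ≤ r) (h2 : 2 < k) {W : Type*} [DecidableEq W]
    (φ : Fin q × Fin (r + 1) ≃ W) :
    ∃ E : Finset (Finset W), (∀ e ∈ E, #e = r) ∧ ¬ HasBergePath E k ∧ #E = q * (k - 1) := by
  let edge : Fin q × Fin (r + 1) → Finset W := fun p =>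
    (({p.1} : Finset (Fin q)) ×ˢ univ.erase p.2).map φ.toEmbedding
  have hmem : ∀ p x, x ∈ edge p ↔ (φ.symm x).1 = p.1 ∧ (φ.symm x).2 ≠ p.2 := by
    intro p x
    simp only [edge, mem_map_equiv, mem_product, mem_singleton, mem_erase, mem_univ, and_true]
  have hedge : ∀ p, #(edge p) = r := by
    intro p
    simp [edge]
  have hfst : ∀ p p' x, x ∈ edge p → x ∈ edge p' → p.1 = p'.1 := fun p p' x h h' =>
    ((hmem p x).1 h).1.symm.trans ((hmem p' x).1 h').1
  have hinj : Function.Injective edge := by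
    intro p p' hpp
    obtain ⟨x, hx⟩ := card_pos.1 (by rw [hedge p]; omega : 0 < #(edge p))
    have h1 := hfst p p' x hx (hpp ▸ hx)
    refine Prod.ext h1 ?_
    by_contra h2
    have : φ (p'.1, p'.2) ∈ edge p := (hmem _ _).2 (by simpa [h1] using Ne.symm h2)
    rw [hpp, hmem] at this
    simp at this
  let I : Finset (Fin (r + 1)) := univ.filter fun t => (t : ℕ) < k - 1
  have hI : #I = k - 1 := by
    rw [Fin.card_filter_val_lt]
    omega
  refine ⟨(univ ×ˢ I).image edge, ?_, ?_, ?_⟩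
  · intro e he
    obtain ⟨p, -, rfl⟩ := mem_image.1 he
    exact hedge p
  · rintro ⟨v, h, hv, hh, hE, hm⟩
    choose p hp hpe using fun i => mem_image.1 (hE i)
    have hstep : ∀ i (hi : i < k), (p ⟨i, hi⟩).1 = (p ⟨0, by omega⟩).1 := by
      intro i
      induction i with
      | zero => exact fun _ => rfl
      | succ i ih =>
        intro hi
        rw [← ih (by omega)]
        refine hfst _ _ (v ⟨i + 1, by omega⟩) ?_ ?_
        · rw [hpe]; exact (hm ⟨i + 1, hi⟩).1
        · rw [hpe]; exact (hm ⟨i, by omega⟩).2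
    have hcard : #(univ : Finset (Fin k)) ≤ #I := by
      refine card_le_card_of_injOn (fun i => (p i).2) (fun i _ => (mem_product.1 (hp i)).2) ?_
      intro i _ j _ hij
      refine hh ?_
      rw [← hpe i, ← hpe j]
      exact congrArg edge (Prod.ext ((hstep i i.2).trans (hstep j j.2).symm) hij)
    rw [hI, card_univ, Fintype.card_fin] at hcard
    omega
  · rw [card_image_of_injective _ hinj, card_product, hI, card_univ, Fintype.card_fin]

end BergePathTuran

/-- If `r ≥ k > 2`, then every `n`-vertex `r`-uniform hypergraph without a Berge
path of length `k` has at most `n(k−1)/(r+1)` hyperedges, and if `r+1 ∣ n` this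
bound is attained. -/
theorem berge_path_turan_small_k (r k : ℕ) (hk : k ≤ r) (h2 : 2 < k) :
    (∀ (n : ℕ) (E : Finset (Finset (Fin n))), (∀ e ∈ E, e.card = r) →
        ¬ HasBergePath E k →
        (E.card : ℚ) ≤ (n : ℚ) * ((k : ℚ) - 1) / ((r : ℚ) + 1)) ∧
    (∀ n : ℕ, (r + 1) ∣ n → ∃ E : Finset (Finset (Fin n)),
        (∀ e ∈ E, e.card = r) ∧ ¬ HasBergePath E k ∧
        (E.card : ℚ) = (n : ℚ) * ((k : ℚ) - 1) / ((r : ℚ) + 1)) := by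
  have hr : (0 : ℚ) < (r : ℚ) + 1 := by positivity
  have hk1 : ((k - 1 : ℕ) : ℚ) = (k : ℚ) - 1 := by
    rw [Nat.cast_sub (by omega), Nat.cast_one]
  constructor
  · intro n E hE hno
    have := BergePathTuran.card_mul_le hk h2 Finset.univ E (fun e _ => e.subset_univ) hE hno
    rw [Finset.card_univ, Fintype.card_fin] at this
    rw [le_div_iff₀ hr, ← hk1]
    exact_mod_cast this
  · rintro n ⟨q, rfl⟩
    obtain ⟨E, hE, hno, hcard⟩ := BergePathTuran.exists_extremal hk h2
      (finProdFinEquiv.trans (finCongr (Nat.mul_comm q (r + 1))))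
    refine ⟨E, hE, hno, ?_⟩
    rw [eq_div_iff hr.ne', hcard, ← hk1]
    push_cast
    ring
end
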